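/- Let G be a bipartite finite simple graph on [n] without isolated vertices and I(G) its edge ideal in S = k[x_1,…,x_n]. Then S/I(G)^{(2)} is Buchsbaum if and only if G is a path of length 3 (a path on 4 vertices) or a disjoint union of edges. -/

import Mathlib

open MvPolynomial CategoryTheory CategoryTheory.Limits

noncomputable section

/-- A simplicial complex on a vertex set `V`: a collection of finite subsets of `V`
closed under taking subsets. -/
def IsSimplicialComplex {V : Type} (Δ : Set (Finset V)) : Prop :=
  ∀ F ∈ Δ, ∀ G : Finset V, G ⊆ F → G ∈ Δ

/-- The dimension of a simplicial complex: `max {|F| - 1 : F ∈ Δ}`. -/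
def complexDim {V : Type} (Δ : Set (Finset V)) : ℤ :=
  sSup ((fun F : Finset V => (F.card : ℤ) - 1) '' Δ)

/-- The star of a face: `st_Δ(F) = {H ∈ Δ : H ∪ F ∈ Δ}`. -/
def complexStar {V : Type} [DecidableEq V] (Δ : Set (Finset V)) (F : Finset V) :
    Set (Finset V) :=
  {H | H ∈ Δ ∧ H ∪ F ∈ Δ}

/-- The facets (maximal faces) of a simplicial complex. -/
def facets {V : Type} (Δ : Set (Finset V)) : Set (Finset V) :=
  {F | F ∈ Δ ∧ ∀ G ∈ Δ, F ⊆ G → F = G}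

/-- The Stanley–Reisner ideal of a simplicial complex `Δ`:
generated by the squarefree monomials `∏_{i ∈ F} x_i` with `F ∉ Δ`. -/
def srIdeal (k : Type) [Field k] {V : Type} (Δ : Set (Finset V)) :
    Ideal (MvPolynomial V k) :=
  Ideal.span {m | ∃ F : Finset V, F ∉ Δ ∧ m = ∏ i ∈ F, X i}

/-- The face prime `P_F = (x_j : j ∉ F)`. -/
def facePrime (k : Type) [Field k] {V : Type} (F : Finset V) :
    Ideal (MvPolynomial V k) :=
  Ideal.span ((X : V → MvPolynomial V k) '' {j | j ∉ F})

/-- The `m`-th symbolic power of the Stanley–Reisner ideal: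
`I_Δ^{(m)} = ⋂_{F facet of Δ} P_F^m`. -/
def symbolicPower (k : Type) [Field k] {V : Type} (Δ : Set (Finset V)) (m : ℕ) :
    Ideal (MvPolynomial V k) :=
  ⨅ F ∈ facets Δ, (facePrime k F) ^ m

/-- The homogeneous maximal ideal `m = (x_1, …, x_n)` of the polynomial ring. -/
def maxIdeal (k : Type) [Field k] (V : Type) : Ideal (MvPolynomial V k) :=
  Ideal.span (Set.range (X : V → MvPolynomial V k))

/-- The `i`-th local cohomology module `H^i_m(S/I)`. -/
def locCoh (k : Type) [Field k] (V : Type) (I : Ideal (MvPolynomial V k)) (i : ℕ) :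
    ModuleCat (MvPolynomial V k) :=
  (localCohomology (maxIdeal k V) i).obj
    (ModuleCat.of (MvPolynomial V k) (MvPolynomial V k ⧸ I))

/-- `S/I` is Cohen–Macaulay: `H^i_m(S/I) = 0` for all `i < dim S/I`. -/
def quotCM (k : Type) [Field k] (V : Type) (I : Ideal (MvPolynomial V k)) : Prop :=
  ∀ i : ℕ, (i : WithBot (WithTop ℕ)) < ringKrullDim (MvPolynomial V k ⧸ I) →
    Subsingleton (locCoh k V I i)

/-- `S/I` is generalized Cohen–Macaulay: `H^i_m(S/I)` has finite length for all
`i < dim S/I`. -/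
def quotGCM (k : Type) [Field k] (V : Type) (I : Ideal (MvPolynomial V k)) : Prop :=
  ∀ i : ℕ, (i : WithBot (WithTop ℕ)) < ringKrullDim (MvPolynomial V k ⧸ I) →
    IsFiniteLength (MvPolynomial V k) (locCoh k V I i)

/-- `S/I` is `r`-Buchsbaum: `m^r · H^i_m(S/I) = 0` for all `i < dim S/I`. -/
def quotKBuchsbaum (k : Type) [Field k] (V : Type) (I : Ideal (MvPolynomial V k))
    (r : ℕ) : Prop :=
  ∀ i : ℕ, (i : WithBot (WithTop ℕ)) < ringKrullDim (MvPolynomial V k ⧸ I) →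
    ∀ x ∈ (maxIdeal k V) ^ r, ∀ y : locCoh k V I i, x • y = 0

/-- The canonical map `Ext^i_S(S/m, S/I) → H^i_m(S/I)`, realized as the colimit
injection at the first power of `m` in the direct system defining local cohomology. -/
def canonicalExtToLocCoh (k : Type) [Field k] (V : Type) (I : Ideal (MvPolynomial V k))
    (i : ℕ) :
    ((localCohomology.diagram (localCohomology.idealPowersDiagram (maxIdeal k V)) i).obj
        (Opposite.op (Opposite.op (1 : ℕ)))).obj
      (ModuleCat.of (MvPolynomial V k) (MvPolynomial V k ⧸ I)) ⟶ locCoh k V I i :=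
  letI := localCohomology.hasColimitDiagram.{0,0}
    (localCohomology.idealPowersDiagram (maxIdeal k V)) i
  (colimit.ι (localCohomology.diagram (localCohomology.idealPowersDiagram (maxIdeal k V)) i)
    (Opposite.op (Opposite.op (1 : ℕ)))).app (ModuleCat.of (MvPolynomial V k) (MvPolynomial V k ⧸ I))

/-- `S/I` is Buchsbaum: the canonical map `Ext^i_S(S/m, S/I) → H^i_m(S/I)` is
surjective for all `i < dim S/I`. -/
def quotBuchsbaum (k : Type) [Field k] (V : Type) (I : Ideal (MvPolynomial V k)) : Prop :=
  ∀ i : ℕ, (i : WithBot (WithTop ℕ)) < ringKrullDim (MvPolynomial V k ⧸ I) →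
    Function.Surjective (canonicalExtToLocCoh k V I i)

/-- A simplicial complex is Cohen–Macaulay if its Stanley–Reisner ring is
Cohen–Macaulay over every field. -/
def complexCM {V : Type} (Δ : Set (Finset V)) : Prop :=
  ∀ (k : Type) [Field k], quotCM k V (srIdeal k Δ)

/-- A simplicial complex is Buchsbaum if its Stanley–Reisner ring is Buchsbaum over
every field. -/
def complexBuchsbaum {V : Type} (Δ : Set (Finset V)) : Prop :=
  ∀ (k : Type) [Field k], quotBuchsbaum k V (srIdeal k Δ)

/-- The independence complex of a graph: faces are the independent sets. -/
def indepComplex {V : Type} (G : SimpleGraph V) : Set (Finset V) :=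
  {F | ∀ i ∈ F, ∀ j ∈ F, ¬ G.Adj i j}

/-- The edge ideal `I(G) = (x_i x_j : ij ∈ E(G))`. -/
def edgeIdeal (k : Type) [Field k] {V : Type} (G : SimpleGraph V) :
    Ideal (MvPolynomial V k) :=
  Ideal.span {m | ∃ i j : V, G.Adj i j ∧ m = X i * X j}

/-- The independence number `α(G)`. -/
def indepNumber {V : Type} (G : SimpleGraph V) : ℕ :=
  sSup {c | ∃ F ∈ indepComplex G, F.card = c}

/-- A graph is Cohen–Macaulay if its independence complex is. -/
def graphCM {V : Type} (G : SimpleGraph V) : Prop :=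
  complexCM (indepComplex G)

/-- The vertex set of the localization `G_{pq} = G \ (N(p) ∪ N(q))` of `G` at an
edge `pq`. -/
def edgeLocSet {V : Type} (G : SimpleGraph V) (p q : V) : Set V :=
  {v | v ∉ G.neighborSet p ∪ G.neighborSet q}

/-- The localization of `G` at an edge `pq`: the induced subgraph on the vertices not
adjacent to `p` or `q` (this removes `p` and `q` as well). -/
def edgeLoc {V : Type} (G : SimpleGraph V) (p q : V) :
    SimpleGraph (edgeLocSet G p q) :=
  G.induce (edgeLocSet G p q)

/-- `G` is special Cohen–Macaulay: `G` is Cohen–Macaulay and for every edge `pq`,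
`G_{pq}` is Cohen–Macaulay with `α(G_{pq}) = α(G) - 1`. -/
def specialCM {V : Type} (G : SimpleGraph V) : Prop :=
  graphCM G ∧ ∀ p q : V, G.Adj p q →
    graphCM (edgeLoc G p q) ∧ indepNumber (edgeLoc G p q) + 1 = indepNumber G

/-- The vertex set of `G_i = G \ ({i} ∪ N(i))`. -/
def vertexLocSet {V : Type} (G : SimpleGraph V) (i : V) : Set V :=
  {v | v ≠ i ∧ v ∉ G.neighborSet i}

/-- `G_i = G \ ({i} ∪ N(i))`: the induced subgraph obtained by deleting `i` and all
its neighbors. -/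
def vertexLoc {V : Type} (G : SimpleGraph V) (i : V) :
    SimpleGraph (vertexLocSet G i) :=
  G.induce (vertexLocSet G i)

/-- A graph is unmixed if all its maximal independent sets have the same cardinality. -/
def graphUnmixed {V : Type} (G : SimpleGraph V) : Prop :=
  ∀ F ∈ facets (indepComplex G), ∀ F' ∈ facets (indepComplex G), F.card = F'.card

/-- `G` has no isolated vertices. -/
def noIsolated {V : Type} (G : SimpleGraph V) : Prop :=
  ∀ v : V, ∃ w : V, G.Adj v w

end

noncomputable section

namespace BuchsbaumAux

section Cochains

variable {R : Type} [CommRing R]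

/-- The cochain map obtained by applying `Hom(-, Y)` to a chain map. -/
def linYonMap {P Q : ChainComplex (ModuleCat.{0} R) ℕ} (φ : P ⟶ Q) (Y : ModuleCat.{0} R) :
    Q.linearYonedaObj R Y ⟶ P.linearYonedaObj R Y :=
  (HomologicalComplex.unopFunctor _ _).map
    ((((linearYoneda R (ModuleCat.{0} R)).obj Y).rightOp.mapHomologicalComplex _).map φ).op

lemma homologyUnop_hom_naturality {V ι : Type*} [Category V] [Abelian V] {c : ComplexShape ι}
    {K L : HomologicalComplex Vᵒᵖ c} (φ : K ⟶ L) (i : ι) :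
    HomologicalComplex.homologyMap ((HomologicalComplex.unopFunctor _ _).map φ.op) i ≫
      (K.homologyUnop i).hom = (L.homologyUnop i).hom ≫ (HomologicalComplex.homologyMap φ i).unop := by
  have := HomologicalComplex.homologyOp_hom_naturality
    (((HomologicalComplex.unopFunctor V c).map φ.op)) i
  exact (congrArg Quiver.Hom.unop this).symm

lemma isoExt_inv_naturality {X X' : ModuleCat.{0} R} (f : X' ⟶ X) (P' : ProjectiveResolution X')
    (P : ProjectiveResolution X) (φ : P'.complex ⟶ P.complex)
    (comm : φ.f 0 ≫ P.π.f 0 = P'.π.f 0 ≫ f) (n : ℕ) (Y : ModuleCat.{0} R) :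
    (P.isoExt n Y).inv ≫ ((Ext R (ModuleCat.{0} R) n).map f.op).app Y =
      HomologicalComplex.homologyMap (linYonMap φ Y) n ≫ (P'.isoExt (R := R) n Y).inv := by
  have h1 := homologyUnop_hom_naturality
    ((((linearYoneda R (ModuleCat.{0} R)).obj Y).rightOp.mapHomologicalComplex _).map φ) n
  have h2 := ProjectiveResolution.isoLeftDerivedObj_hom_naturality f P' P φ comm
    (((linearYoneda R (ModuleCat.{0} R)).obj Y).rightOp) n
  have h3 := congrArg Quiver.Hom.unop h2
  have h4 : (P.isoExt n Y).inv = (HomologicalComplex.homologyUnop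
      (((((linearYoneda R (ModuleCat.{0} R)).obj Y).rightOp.mapHomologicalComplex _).obj
        P.complex)) n).hom ≫
      (P.isoLeftDerivedObj ((linearYoneda R (ModuleCat.{0} R)).obj Y).rightOp n).hom.unop := rfl
  have h5 : (P'.isoExt n Y).inv = (HomologicalComplex.homologyUnop
      (((((linearYoneda R (ModuleCat.{0} R)).obj Y).rightOp.mapHomologicalComplex _).obj
        P'.complex)) n).hom ≫
      (P'.isoLeftDerivedObj ((linearYoneda R (ModuleCat.{0} R)).obj Y).rightOp n).hom.unop := rfl
  rw [h4, h5]
  refine (Category.assoc _ _ _).trans ?_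
  refine ((congrArg (fun t => _ ≫ t) h3).trans ?_)
  refine (Category.assoc _ _ _).symm.trans ?_
  refine ((congrArg (fun t => t ≫ _) h1.symm).trans ?_)
  exact Category.assoc _ _ _

section Classes

variable {X : ModuleCat.{0} R} (P : ProjectiveResolution X) (n : ℕ) (Y : ModuleCat.{0} R)

/-- The cycle attached to a cocycle. -/
def cocycleMk (f : P.complex.X n ⟶ Y) (hf : P.complex.d (n + 1) n ≫ f = 0) :
    (P.complex.linearYonedaObj R Y).cycles n :=
  HomologicalComplex.cyclesMk (P.complex.linearYonedaObj R Y) (i := n) f (n + 1) (by simp) hf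

lemma iCycles_cocycleMk (f : P.complex.X n ⟶ Y) (hf : P.complex.d (n + 1) n ≫ f = 0) :
    (P.complex.linearYonedaObj R Y).iCycles n (cocycleMk P n Y f hf) = f :=
  HomologicalComplex.i_cyclesMk (P.complex.linearYonedaObj R Y) (i := n) f (n + 1) (by simp) hf

lemma iCycles_injective : Function.Injective ((P.complex.linearYonedaObj R Y).iCycles n) :=
  (ModuleCat.mono_iff_injective _).1 inferInstance

lemma cocycleMk_surjective (c : (P.complex.linearYonedaObj R Y).cycles n) :
    ∃ f hf, cocycleMk P n Y f hf = c := by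
  refine ⟨(P.complex.linearYonedaObj R Y).iCycles n c, ?_, ?_⟩
  · have := (P.complex.linearYonedaObj R Y).iCycles_d n (n + 1)
    exact congrArg (fun t => t.hom c) this
  · apply iCycles_injective
    exact iCycles_cocycleMk P n Y _ _

/-- The class of a cocycle in the derived-functor `Ext`. -/
def oldMk (f : P.complex.X n ⟶ Y) (hf : P.complex.d (n + 1) n ≫ f = 0) :
    ((Ext R (ModuleCat.{0} R) n).obj (Opposite.op X)).obj Y :=
  (P.isoExt n Y).inv ((P.complex.linearYonedaObj R Y).homologyπ n (cocycleMk P n Y f hf))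

lemma oldMk_surjective (x : ((Ext R (ModuleCat.{0} R) n).obj (Opposite.op X)).obj Y) :
    ∃ f hf, oldMk P n Y f hf = x := by
  obtain ⟨y, rfl⟩ := (ModuleCat.epi_iff_surjective (P.isoExt n Y).inv).1 inferInstance x
  obtain ⟨c, rfl⟩ := (ModuleCat.epi_iff_surjective
    ((P.complex.linearYonedaObj R Y).homologyπ n)).1 inferInstance y
  obtain ⟨f, hf, rfl⟩ := cocycleMk_surjective P n Y c
  exact ⟨f, hf, rfl⟩

lemma oldMk_eq_iff (f g : P.complex.X n ⟶ Y) (hf hg) :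
    oldMk P n Y f hf = oldMk P n Y g hg ↔
      ∃ h : P.complex.X ((ComplexShape.up ℕ).prev n) ⟶ Y, P.complex.d n _ ≫ h = f - g := by
  unfold oldMk
  rw [((ModuleCat.mono_iff_injective (P.isoExt n Y).inv).1 inferInstance).eq_iff,
    ← sub_eq_zero, ← map_sub]
  set K := P.complex.linearYonedaObj R Y
  have hex : (ShortComplex.mk (K.toCycles _ n) (K.homologyπ n)
      (K.toCycles_comp_homologyπ ((ComplexShape.up ℕ).prev n) n)).Exact :=
    ShortComplex.exact_of_g_is_cokernel _ (K.homologyIsCokernel _ n rfl)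
  constructor
  · intro h0
    obtain ⟨h, hh⟩ := (ShortComplex.moduleCat_exact_iff _).1 hex _ h0
    refine ⟨h, ?_⟩
    have := congrArg (K.iCycles n) hh
    rw [map_sub, iCycles_cocycleMk, iCycles_cocycleMk] at this
    exact (congrArg (fun t => t.hom h)
      (K.toCycles_i ((ComplexShape.up ℕ).prev n) n)).symm.trans this
  · rintro ⟨h, hh⟩
    have : cocycleMk P n Y f hf - cocycleMk P n Y g hg = K.toCycles _ n h := by
      apply iCycles_injective
      rw [map_sub, iCycles_cocycleMk, iCycles_cocycleMk]
      refine hh.symm.trans ?_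
      exact (congrArg (fun t => t.hom h) (K.toCycles_i ((ComplexShape.up ℕ).prev n) n)).symm
    rw [this]
    exact congrArg (fun t => t.hom h) (K.toCycles_comp_homologyπ ((ComplexShape.up ℕ).prev n) n)

lemma map_oldMk {X' : ModuleCat.{0} R} (t : X' ⟶ X) (P' : ProjectiveResolution X')
    (φ : P'.Hom P t)
    (f : P.complex.X n ⟶ Y) (hf : P.complex.d (n + 1) n ≫ f = 0) :
    ((Ext R (ModuleCat.{0} R) n).map t.op).app Y (oldMk P n Y f hf) =
      oldMk P' n Y (φ.hom.f n ≫ f) (by rw [← φ.hom.comm_assoc, hf, comp_zero]) := by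
  have h := isoExt_inv_naturality t P' P φ.hom (by simpa using φ.hom_f_zero_comp_π_f_zero) n Y
  have h1 := congrArg (fun s => s.hom ((P.complex.linearYonedaObj R Y).homologyπ n
    (cocycleMk P n Y f hf))) h
  refine h1.trans ?_
  have h2 := congrArg (fun s => s.hom (cocycleMk P n Y f hf))
    (HomologicalComplex.homologyπ_naturality (linYonMap φ.hom Y) n)
  refine (congrArg (P'.isoExt n Y).inv h2).trans ?_
  have h3 : HomologicalComplex.cyclesMap (linYonMap φ.hom Y) n (cocycleMk P n Y f hf) =
      cocycleMk P' n Y (φ.hom.f n ≫ f) (by rw [← φ.hom.comm_assoc, hf, comp_zero]) := by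
    apply iCycles_injective
    rw [iCycles_cocycleMk]
    have h4 := congrArg (fun s => s.hom (cocycleMk P n Y f hf))
      (HomologicalComplex.cyclesMap_i (linYonMap φ.hom Y) n)
    refine h4.trans ?_
    exact congrArg (fun t => φ.hom.f n ≫ t) (iCycles_cocycleMk P n Y f hf)
  exact congrArg (fun t => (P'.isoExt n Y).inv ((P'.complex.linearYonedaObj R Y).homologyπ n t)) h3

lemma extMk_eq_iff (f g : P.complex.X n ⟶ Y) (hf hg) :
    P.extMk f (n + 1) rfl hf = P.extMk g (n + 1) rfl hg ↔
      ∃ h : P.complex.X ((ComplexShape.up ℕ).prev n) ⟶ Y, P.complex.d n _ ≫ h = f - g := by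
  rw [← sub_eq_zero, P.sub_extMk]
  cases n with
  | succ n => rw [P.extMk_eq_zero_iff _ _ _ _ n rfl, CochainComplex.prev_nat_succ]
  | zero =>
    have hd : P.complex.d 0 ((ComplexShape.up ℕ).prev 0) = 0 := P.complex.shape _ _ (by simp)
    simp only [hd, zero_comp, exists_const]
    constructor
    · intro h
      have h2 := congrArg P.extEquivCohomologyClass h
      rw [P.extEquivCohomologyClass_extMk, P.extEquivCohomologyClass_zero,
        CochainComplex.HomComplex.CohomologyClass.mk_eq_zero_iff,
        CochainComplex.HomComplex.Cocycle.toSingleMk_mem_coboundaries_iff _ _ _ _ _ 1 (by simp)] at h2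
      obtain ⟨u, hu⟩ := h2
      have hz : P.cochainComplex.d (-((0 : ℕ) : ℤ)) 1 = 0 :=
        (CochainComplex.isZero_of_isStrictlyLE P.cochainComplex 0 1).eq_of_tgt _ _
      rw [hz, zero_comp] at hu
      rw [← cancel_epi (P.cochainComplexXIso (-((0 : ℕ) : ℤ)) 0 rfl).hom, ← hu, comp_zero]
    · intro h
      simp [← h]

lemma old_eq_iff_ext_eq (f g : P.complex.X n ⟶ Y) (hf hg) :
    oldMk P n Y f hf = oldMk P n Y g hg ↔
    P.extMk f (n + 1) rfl hf = P.extMk g (n + 1) rfl hg := by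
  rw [oldMk_eq_iff, extMk_eq_iff]

end Classes

end Cochains

section Bridge

variable {R : Type} [CommRing R] (J : Ideal R)

/-- The quotient `R ⧸ J ^ r` as an object. -/
abbrev powQuot (r : ℕ) : ModuleCat.{0} R := ModuleCat.of R (R ⧸ J ^ r)

/-- The projection `R ⧸ J ^ s ⟶ R ⧸ J ^ r` for `r ≤ s`. -/
def powProj {r s : ℕ} (h : r ≤ s) : powQuot J s ⟶ powQuot J r :=
  ModuleCat.ofHom (Submodule.mapQ _ _ LinearMap.id (Ideal.pow_le_pow_right h))

/-- The colimit of the `Ext (R ⧸ J ^ r) M i` is the image of the term `r = 1`. -/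
def ExtSurj (i : ℕ) (M : ModuleCat.{0} R) : Prop :=
  ∀ (r : ℕ) (ξ : Abelian.Ext (powQuot J r) M i), ∃ (η : Abelian.Ext (powQuot J 1) M i) (s : ℕ)
    (h : r ≤ s) (h' : 1 ≤ s), (Abelian.Ext.mk₀ (powProj J h)).comp ξ (zero_add i) =
      (Abelian.Ext.mk₀ (powProj J h')).comp η (zero_add i)

/-- Elements of the two models of `Ext` represented by a common cocycle. -/
def SameClass {X Y : ModuleCat.{0} R} {n : ℕ}
    (x : ((Ext R (ModuleCat.{0} R) n).obj (Opposite.op X)).obj Y) (ξ : Abelian.Ext X Y n) : Prop :=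
  ∃ f hf, oldMk (projectiveResolution X) n Y f hf = x ∧
    (projectiveResolution X).extMk f (n + 1) rfl hf = ξ

section

variable {X X' Y : ModuleCat.{0} R} {n : ℕ}

lemma SameClass.exists_right (x : ((Ext R (ModuleCat.{0} R) n).obj (Opposite.op X)).obj Y) :
    ∃ ξ : Abelian.Ext X Y n, SameClass x ξ := by
  obtain ⟨f, hf, h⟩ := oldMk_surjective (projectiveResolution X) n Y x
  exact ⟨_, f, hf, h, rfl⟩

lemma SameClass.exists_left (ξ : Abelian.Ext X Y n) :
    ∃ x : ((Ext R (ModuleCat.{0} R) n).obj (Opposite.op X)).obj Y, SameClass x ξ := by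
  obtain ⟨f, hf, h⟩ := (projectiveResolution X).extMk_surjective ξ (n + 1) rfl
  exact ⟨_, f, hf, rfl, h⟩

lemma SameClass.eq_iff_eq {x x' : ((Ext R (ModuleCat.{0} R) n).obj (Opposite.op X)).obj Y}
    {ξ ξ' : Abelian.Ext X Y n} (h : SameClass x ξ) (h' : SameClass x' ξ') : x = x' ↔ ξ = ξ' := by
  obtain ⟨f, hf, rfl, rfl⟩ := h
  obtain ⟨f', hf', rfl, rfl⟩ := h'
  exact old_eq_iff_ext_eq _ _ _ _ _ _ _

lemma SameClass.map {x : ((Ext R (ModuleCat.{0} R) n).obj (Opposite.op X)).obj Y}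
    {ξ : Abelian.Ext X Y n} (h : SameClass x ξ) (t : X' ⟶ X) :
    SameClass (((Ext R (ModuleCat.{0} R) n).map t.op).app Y x)
      ((Abelian.Ext.mk₀ t).comp ξ (zero_add n)) := by
  obtain ⟨f, hf, rfl, rfl⟩ := h
  let φ : (projectiveResolution X').Hom (projectiveResolution X) t :=
    { hom := ProjectiveResolution.lift t _ _
      hom_f_zero_comp_π_f_zero :=
        (ProjectiveResolution.lift_commutes_zero t _ _).trans (by simp) }
  rw [map_oldMk (t := t) (φ := φ), ProjectiveResolution.mk₀_comp_extMk (φ := φ)]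
  exact ⟨_, _, rfl, rfl⟩

end

theorem colimit_ι_surjective_iff_extSurj (i : ℕ) [HasColimit
    (localCohomology.diagram.{0,0} (localCohomology.idealPowersDiagram J) i)]
    (M : ModuleCat.{0} R) :
    Function.Surjective ((colimit.ι
      (localCohomology.diagram.{0,0} (localCohomology.idealPowersDiagram J) i)
        (Opposite.op (Opposite.op (1 : ℕ)))).app M) ↔ ExtSurj J i M := by
  set D := localCohomology.diagram.{0,0} (localCohomology.idealPowersDiagram J) i with hD
  have hc : IsColimit (((evaluation _ _).obj M).mapCocone (colimit.cocone D)) :=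
    isColimitOfPreserves ((evaluation _ _).obj M) (colimit.isColimit D)
  have key : ∀ (r s : ℕ) (x : (D.obj (Opposite.op (Opposite.op r))).obj M)
      (y : (D.obj (Opposite.op (Opposite.op s))).obj M)
      (ξ : Abelian.Ext (powQuot J r) M i) (η : Abelian.Ext (powQuot J s) M i),
      SameClass x ξ → SameClass y η →
      ((colimit.ι D (Opposite.op (Opposite.op r))).app M x =
        (colimit.ι D (Opposite.op (Opposite.op s))).app M y ↔
      ∃ (t : ℕ) (h : r ≤ t) (h' : s ≤ t), (Abelian.Ext.mk₀ (powProj J h)).comp ξ (zero_add i) =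
      (Abelian.Ext.mk₀ (powProj J h')).comp η (zero_add i)) := by
    intro r s x y ξ η hx hy
    constructor
    · intro h
      obtain ⟨⟨⟨t⟩⟩, f, g, hfg⟩ := Concrete.isColimit_exists_of_rep_eq _ hc x y h
      refine ⟨t, leOfHom f.unop.unop, leOfHom g.unop.unop, ?_⟩
      exact ((hx.map (powProj J (leOfHom f.unop.unop))).eq_iff_eq
        (hy.map (powProj J (leOfHom g.unop.unop)))).1 hfg
    · rintro ⟨t, h, h', e⟩
      have e' := ((hx.map (powProj J h)).eq_iff_eq (hy.map (powProj J h'))).2 e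
      have w1 := congrArg (fun s => (s.app M).hom x) (colimit.w D (homOfLE h).op.op)
      have w2 := congrArg (fun s => (s.app M).hom y) (colimit.w D (homOfLE h').op.op)
      refine w1.symm.trans (Eq.trans ?_ w2)
      exact congrArg ((colimit.ι D (Opposite.op (Opposite.op t))).app M).hom e'
  constructor
  · intro H r ξ
    obtain ⟨x, hx⟩ := SameClass.exists_left ξ
    obtain ⟨y, hy⟩ := H ((colimit.ι D (Opposite.op (Opposite.op r))).app M x)
    obtain ⟨η, hη⟩ := SameClass.exists_right y
    exact ⟨η, (key r 1 x y ξ η hx hη).1 hy.symm⟩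
  · intro H z
    obtain ⟨⟨⟨r⟩⟩, x, rfl⟩ := Concrete.isColimit_exists_rep _ hc z
    obtain ⟨ξ, hξ⟩ := SameClass.exists_right x
    obtain ⟨η, h⟩ := H r ξ
    obtain ⟨y, hy⟩ := SameClass.exists_left η
    exact ⟨y, ((key r 1 x y ξ η hξ hy).2 h).symm⟩

theorem quotBuchsbaum_iff (k : Type) [Field k] (V : Type) (I : Ideal (MvPolynomial V k)) :
    quotBuchsbaum k V I ↔
      ∀ i : ℕ, (i : WithBot (WithTop ℕ)) < ringKrullDim (MvPolynomial V k ⧸ I) →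
        ExtSurj (maxIdeal k V) i (ModuleCat.of _ (MvPolynomial V k ⧸ I)) := by
  refine forall₂_congr fun i hi => ?_
  have := localCohomology.hasColimitDiagram.{0,0}
    (localCohomology.idealPowersDiagram (maxIdeal k V)) i
  exact colimit_ι_surjective_iff_extSurj (maxIdeal k V) i _

end Bridge

section ExtLemmas

open Abelian

variable {R : Type} [CommRing R] (J : Ideal R)

/-- Precomposition of an extension class with `R ⧸ J ^ s ⟶ R ⧸ J ^ r`. -/
def extRes {r s i : ℕ} (h : r ≤ s) {M : ModuleCat.{0} R} (ξ : Ext (powQuot J r) M i) :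
    Ext (powQuot J s) M i :=
  (Ext.mk₀ (powProj J h)).comp ξ (zero_add i)

/-- `Ext i (R ⧸ J ^ r, M) = 0` for all `i < d` and all `r`. -/
def ExtVanish (d : ℕ) (M : Type) [AddCommGroup M] [Module R M] : Prop :=
  ∀ i < d, ∀ (r : ℕ) (ξ : Ext (powQuot J r) (ModuleCat.of R M) i), ξ = 0

/-- Multiplication by `z` is zero on the colimit of the `Ext i (R ⧸ J ^ r, M)`. -/
def ExtKill (z : R) (i : ℕ) (M : Type) [AddCommGroup M] [Module R M] : Prop :=
  ∀ (r : ℕ) (ξ : Ext (powQuot J r) (ModuleCat.of R M) i), ∃ (s : ℕ) (h : r ≤ s),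
    extRes J h (z • ξ) = 0

variable {J}

lemma powProj_comp {r s t : ℕ} (h : r ≤ s) (h' : s ≤ t) :
    powProj J h' ≫ powProj J h = powProj J (h.trans h') := by
  ext
  rfl

lemma extRes_extRes {r s t i : ℕ} (h : r ≤ s) (h' : s ≤ t) {M : ModuleCat.{0} R}
    (ξ : Ext (powQuot J r) M i) : extRes J h' (extRes J h ξ) = extRes J (h.trans h') ξ := by
  rw [extRes, extRes, Ext.mk₀_comp_mk₀_assoc, powProj_comp, extRes]

lemma extRes_comp {r s i j l : ℕ} (h : r ≤ s) {M N : ModuleCat.{0} R}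
    (ξ : Ext (powQuot J r) M i) (α : Ext M N j) (e : i + j = l) :
    extRes J h (ξ.comp α e) = (extRes J h ξ).comp α e := by
  rw [extRes, extRes, Ext.comp_assoc (h₂₃ := e) (h := by omega)]

lemma extRes_smul {r s i : ℕ} (h : r ≤ s) {M : ModuleCat.{0} R} (z : R)
    (ξ : Ext (powQuot J r) M i) : extRes J h (z • ξ) = z • extRes J h ξ := by
  rw [extRes, extRes, Ext.comp_smul]

lemma extRes_zero {r s i : ℕ} (h : r ≤ s) {M : ModuleCat.{0} R} :
    extRes J h (0 : Ext (powQuot J r) M i) = 0 := by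
  rw [extRes, Ext.comp_zero]

lemma extRes_mk₀ {r s : ℕ} (h : r ≤ s) {M : ModuleCat.{0} R} (u : powQuot J r ⟶ M) :
    extRes J h (Ext.mk₀ u) = Ext.mk₀ (powProj J h ≫ u) := by
  rw [extRes, Ext.mk₀_comp_mk₀]

lemma smul_eq_zero_of_mem_pow {r i : ℕ} {M : ModuleCat.{0} R} (ξ : Ext (powQuot J r) M i)
    {z : R} (hz : z ∈ J ^ r) : z • ξ = 0 := by
  have h : z • 𝟙 (powQuot J r) = 0 := by
    ext
    change z • (Submodule.Quotient.mk 1 : R ⧸ J ^ r) = 0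
    rw [← Submodule.Quotient.mk_smul, Submodule.Quotient.mk_eq_zero]
    simpa using hz
  rw [← Ext.mk₀_id_comp ξ, ← Ext.smul_comp, ← Ext.mk₀_smul, h, Ext.mk₀_zero, Ext.zero_comp]

variable {M₁ M₂ M₃ : Type} [AddCommGroup M₁] [AddCommGroup M₂] [AddCommGroup M₃]
  [Module R M₁] [Module R M₂] [Module R M₃] {f : M₁ →ₗ[R] M₂} {g : M₂ →ₗ[R] M₃}

/-- The short complex attached to an exact pair of linear maps. -/
def exactComplex (h : Function.Exact f g) : ShortComplex (ModuleCat.{0} R) :=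
  ShortComplex.mk (ModuleCat.ofHom f) (ModuleCat.ofHom g)
    (by rw [← ModuleCat.ofHom_comp, h.linearMap_comp_eq_zero]; rfl)

lemma exactComplex_shortExact (h : Function.Exact f g) (hf : Function.Injective f)
    (hg : Function.Surjective g) : (exactComplex h).ShortExact :=
  ModuleCat.shortComplex_shortExact _ h hf hg

lemma ExtVanish.mono {d e : ℕ} (h : ExtVanish J d M₁) (hed : e ≤ d) : ExtVanish J e M₁ :=
  fun i hi => h i (hi.trans_le hed)

lemma ExtVanish.zero : ExtVanish J 0 M₁ := fun i hi => absurd hi (Nat.not_lt_zero i)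

lemma ExtVanish.extSurj {i d : ℕ} (h : ExtVanish J d M₁) (hi : i < d) :
    ExtSurj J i (ModuleCat.of R M₁) :=
  fun r ξ => ⟨0, max r 1, le_max_left _ _, le_max_right _ _, by
    rw [h i hi r ξ, Ext.comp_zero, Ext.comp_zero]⟩

lemma ExtVanish.middle {d : ℕ} (h : Function.Exact f g) (hf : Function.Injective f)
    (hg : Function.Surjective g) (h₁ : ExtVanish J d M₁) (h₃ : ExtVanish J d M₃) :
    ExtVanish J d M₂ := by
  intro i hi r ξ
  obtain ⟨ζ, rfl⟩ := Ext.covariant_sequence_exact₂ _ (exactComplex_shortExact h hf hg) ξ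
    (h₃ i hi r _)
  have : ζ = 0 := h₁ i hi r ζ
  rw [this]
  exact Ext.zero_comp ..

lemma ExtVanish.left {d : ℕ} (h : Function.Exact f g) (hf : Function.Injective f)
    (hg : Function.Surjective g) (h₂ : ExtVanish J (d + 1) M₂) (h₃ : ExtVanish J d M₃) :
    ExtVanish J (d + 1) M₁ := by
  intro i hi r ξ
  have hS := exactComplex_shortExact h hf hg
  have h0 : ξ.comp (Ext.mk₀ (exactComplex h).f) (add_zero i) = 0 := h₂ i hi r _
  cases i with
  | zero =>
    have := hS.mono_f
    apply Ext.postcomp_mk₀_injective_of_mono _ (exactComplex h).f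
    exact h0.trans (map_zero _).symm
  | succ i =>
    obtain ⟨χ, rfl⟩ := Ext.covariant_sequence_exact₁ _ hS ξ h0 rfl
    have : χ = 0 := h₃ i (by omega) r χ
    rw [this]
    exact Ext.zero_comp ..

lemma ExtVanish.of_regular {d : ℕ} {z : R} (hz : z ∈ J) {g : M₁ →ₗ[R] M₃}
    (hinj : ∀ x : M₁, z • x = 0 → x = 0) (h : Function.Exact (z • (LinearMap.id : M₁ →ₗ[R] M₁)) g)
    (hg : Function.Surjective g) (h₃ : ExtVanish J d M₃) : ExtVanish J (d + 1) M₁ := by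
  have hf : Function.Injective (z • (LinearMap.id : M₁ →ₗ[R] M₁)) :=
    (injective_iff_map_eq_zero _).2 fun x hx => hinj x hx
  have hS := exactComplex_shortExact h hf hg
  intro i hi r ξ
  have inj : ∀ ζ : Ext (powQuot J r) (ModuleCat.of R M₁) i, z • ζ = 0 → ζ = 0 := by
    intro ζ hζ
    have h0 : ζ.comp (Ext.mk₀ (exactComplex h).f) (add_zero i) = 0 := by
      rw [Ext.smul_eq_comp_mk₀] at hζ
      exact hζ
    cases i with
    | zero =>
      have := hS.mono_f
      apply Ext.postcomp_mk₀_injective_of_mono _ (exactComplex h).f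
      exact h0.trans (map_zero _).symm
    | succ i =>
      obtain ⟨χ, rfl⟩ := Ext.covariant_sequence_exact₁ _ hS ζ h0 rfl
      have : χ = 0 := h₃ i (by omega) r χ
      rw [this]
      exact Ext.zero_comp ..
  have pow : ∀ s : ℕ, z ^ s • ξ = 0 → ξ = 0 := by
    intro s
    induction s with
    | zero => intro h; simpa using h
    | succ s ih =>
      intro h
      apply ih
      apply inj
      rwa [smul_smul, ← pow_succ']
  exact pow r (smul_eq_zero_of_mem_pow ξ (Ideal.pow_mem_pow hz r))

lemma ExtKill.mul_left {z : R} {i : ℕ} (h : ExtKill J z i M₁) (w : R) :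
    ExtKill J (w * z) i M₁ := by
  intro r ξ
  obtain ⟨s, hs, e⟩ := h r ξ
  refine ⟨s, hs, ?_⟩
  rw [mul_smul, extRes_smul, e, smul_zero]

lemma ExtKill.right {z w : R} {i : ℕ} (h : Function.Exact f g) (hf : Function.Injective f)
    (hg : Function.Surjective g) (h₂ : ExtKill J z i M₂) (h₁ : ExtKill J w (i + 1) M₁) :
    ExtKill J (z * w) i M₃ := by
  have hS := exactComplex_shortExact h hf hg
  intro r (ξ : Ext (powQuot J r) (exactComplex h).X₃ i)
  obtain ⟨s, hs, e⟩ := h₁ r (ξ.comp hS.extClass rfl)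
  replace e : extRes J hs (w • ξ.comp hS.extClass rfl) = 0 := e
  rw [← Ext.smul_comp, extRes_comp] at e
  obtain ⟨ζ, hζ⟩ := Ext.covariant_sequence_exact₃ _ hS _ rfl e
  obtain ⟨t, ht, e'⟩ := h₂ s ζ
  replace e' : extRes J ht (z • ζ) = 0 := e'
  refine ⟨t, hs.trans ht, ?_⟩
  change extRes J (hs.trans ht) ((z * w) • ξ) = 0
  rw [← extRes_extRes hs ht, mul_smul, extRes_smul, ← hζ, ← Ext.smul_comp, extRes_comp, e',
    Ext.zero_comp]

lemma ExtKill.of_comp {z w : R} {i : ℕ} (f : M₁ →ₗ[R] M₂) (g : M₂ →ₗ[R] M₁)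
    (h : g ∘ₗ f = w • LinearMap.id) (h₂ : ExtKill J z i M₂) : ExtKill J (w * z) i M₁ := by
  intro r ξ
  obtain ⟨s, hs, e⟩ := h₂ r (ξ.comp (Ext.mk₀ (ModuleCat.ofHom f)) (add_zero i))
  refine ⟨s, hs, ?_⟩
  have h' : w • ξ = (ξ.comp (Ext.mk₀ (ModuleCat.ofHom f)) (add_zero i)).comp
      (Ext.mk₀ (ModuleCat.ofHom g)) (add_zero i) := by
    rw [Ext.comp_assoc_of_third_deg_zero, Ext.mk₀_comp_mk₀, ← ModuleCat.ofHom_comp, h,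
      Ext.smul_eq_comp_mk₀]
    rfl
  rw [mul_comm, mul_smul, h', ← Ext.smul_comp, extRes_comp, e, Ext.zero_comp]

/-- The map `R ⧸ J ^ r ⟶ M` with value `q` at `1`. -/
def torsionHom {M : Type} [AddCommGroup M] [Module R M] (r : ℕ) (q : M)
    (hq : ∀ a ∈ J ^ r, a • q = 0) : powQuot J r ⟶ ModuleCat.of R M :=
  ModuleCat.ofHom (Submodule.liftQ _ (LinearMap.toSpanSingleton R M q) (fun a ha => by
    rw [LinearMap.mem_ker, LinearMap.toSpanSingleton_apply]
    exact hq a ha))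

lemma torsionHom_one {M : Type} [AddCommGroup M] [Module R M] (r : ℕ) (q : M)
    (hq : ∀ a ∈ J ^ r, a • q = 0) :
    (torsionHom r q hq).hom (Submodule.Quotient.mk 1) = q := by
  change (Submodule.liftQ _ (LinearMap.toSpanSingleton R M q) _) (Submodule.Quotient.mk 1) = q
  rw [Submodule.liftQ_apply, LinearMap.toSpanSingleton_apply, one_smul]

lemma smul_eq_zero_of_extKill_zero {z : R} (h : ExtKill J z 0 M₁) (r : ℕ) (q : M₁)
    (hq : ∀ a ∈ J ^ r, a • q = 0) : z • q = 0 := by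
  obtain ⟨s, hs, e⟩ := h r (Ext.mk₀ (torsionHom r q hq))
  rw [← Ext.mk₀_smul, extRes_mk₀, Ext.mk₀_eq_zero_iff] at e
  have := congrArg (fun t => t.hom (Submodule.Quotient.mk 1)) e
  refine Eq.trans ?_ this
  exact congrArg (z • ·) (torsionHom_one r q hq).symm

lemma smul_eq_zero_of_extKill_one {z : R} (h : Function.Exact f g) (hf : Function.Injective f)
    (hg : Function.Surjective g) (h₂ : ExtVanish J 1 M₂) (h₁ : ExtKill J z 1 M₁) (r : ℕ) (q : M₃)
    (hq : ∀ a ∈ J ^ r, a • q = 0) : z • q = 0 := by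
  refine smul_eq_zero_of_extKill_zero ?_ r q hq
  have : ExtKill J 1 0 M₂ := fun r ξ => ⟨r, le_rfl, by
    rw [h₂ 0 one_pos r ξ, smul_zero, extRes_zero]⟩
  simpa using this.right h hf hg h₁

lemma extSurj_zero_of_torsion (H : ∀ (r : ℕ) (q : M₁), (∀ a ∈ J ^ r, a • q = 0) →
    ∀ a ∈ J, a • q = 0) : ExtSurj J 0 (ModuleCat.of R M₁) := by
  intro r ξ
  obtain ⟨u, rfl⟩ := Ext.homEquiv₀.symm.surjective ξ
  have hu : ∀ a ∈ J ^ r, a • u.hom (Submodule.Quotient.mk 1) = 0 := by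
    intro a ha
    rw [← map_smul, ← Submodule.Quotient.mk_smul]
    have : (Submodule.Quotient.mk (a • 1) : R ⧸ J ^ r) = 0 := by
      rw [Submodule.Quotient.mk_eq_zero]; simpa using ha
    rw [this, map_zero]
  refine ⟨Ext.mk₀ (torsionHom 1 (u.hom (Submodule.Quotient.mk 1)) (by simpa using H r _ hu)),
    max r 1, le_max_left _ _, le_max_right _ _, ?_⟩
  change (Ext.mk₀ _).comp (Ext.mk₀ u) _ = _
  rw [Ext.mk₀_comp_mk₀, Ext.mk₀_comp_mk₀]
  congr 1
  ext
  exact (torsionHom_one (J := J) 1 (u.hom (Submodule.Quotient.mk 1))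
    (by simpa using H r _ hu)).symm

lemma ExtSurj.succ {i : ℕ} (h : Function.Exact f g) (hf : Function.Injective f)
    (hg : Function.Surjective g) (h₂ : ExtVanish J (i + 2) M₂)
    (h₃ : ExtSurj J i (ModuleCat.of R M₃)) : ExtSurj J (i + 1) (ModuleCat.of R M₁) := by
  have hS := exactComplex_shortExact h hf hg
  intro r ξ
  obtain ⟨χ, rfl⟩ := Ext.covariant_sequence_exact₁ _ hS ξ (h₂ (i + 1) (by omega) r _) rfl
  obtain ⟨η, s, hs, hs', e⟩ := h₃ r χ
  refine ⟨η.comp hS.extClass rfl, s, hs, hs', ?_⟩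
  have h1 := extRes_comp hs χ hS.extClass rfl
  have h2 := extRes_comp hs' η hS.extClass rfl
  refine h1.trans (Eq.trans ?_ h2.symm)
  exact congrArg (fun t => Ext.comp t hS.extClass rfl) e

lemma ExtSurj.extKill {i : ℕ} {z : R} (hz : z ∈ J) (h : ExtSurj J i (ModuleCat.of R M₁)) :
    ExtKill J z i M₁ := by
  intro r ξ
  obtain ⟨η, s, hs, hs', e⟩ := h r ξ
  refine ⟨s, hs, ?_⟩
  rw [extRes_smul]
  change z • (Ext.mk₀ _).comp ξ _ = 0
  rw [e, ← Ext.comp_smul, smul_eq_zero_of_mem_pow η (by simpa using hz), Ext.comp_zero]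

end ExtLemmas

section IdealSequences

variable {R : Type} [CommRing R] {J : Ideal R}

lemma exact_colon {I K L : Ideal R} (z : R) (hK : ∀ a, a ∈ K ↔ z * a ∈ I)
    (hL : L = I ⊔ Ideal.span {z}) :
    Function.Exact (Submodule.mapQ K I (LinearMap.mulLeft R z) fun a ha => (hK a).1 ha)
      (Submodule.factor (hL ▸ le_sup_left : I ≤ L)) := by
  intro x
  obtain ⟨a, rfl⟩ := Submodule.Quotient.mk_surjective _ x
  subst hL
  constructor
  · intro h
    have h' : a ∈ I ⊔ Ideal.span {z} := (Submodule.Quotient.mk_eq_zero _).1 h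
    obtain ⟨b, hb, c, hc, rfl⟩ := Submodule.mem_sup.1 h'
    obtain ⟨d, rfl⟩ := Ideal.mem_span_singleton'.1 hc
    refine ⟨Submodule.Quotient.mk d, ?_⟩
    change Submodule.Quotient.mk (z * d) = _
    rw [Submodule.Quotient.eq]
    have : z * d - (b + d * z) = -b := by ring
    rw [this]
    exact neg_mem hb
  · rintro ⟨y, hy⟩
    obtain ⟨d, rfl⟩ := Submodule.Quotient.mk_surjective _ y
    rw [← hy]
    change Submodule.Quotient.mk (z * d) = _
    rw [Submodule.Quotient.mk_eq_zero]
    exact Ideal.mem_sup_right (Ideal.mem_span_singleton'.2 ⟨d, mul_comm _ _⟩)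

lemma mapQ_mulLeft_injective {I K : Ideal R} (z : R) (hK : ∀ a, a ∈ K ↔ z * a ∈ I) :
    Function.Injective
      (Submodule.mapQ K I (LinearMap.mulLeft R z) fun a ha => (hK a).1 ha) := by
  refine (injective_iff_map_eq_zero _).2 fun x hx => ?_
  obtain ⟨a, rfl⟩ := Submodule.Quotient.mk_surjective _ x
  have h : z * a ∈ I := (Submodule.Quotient.mk_eq_zero _).1 hx
  exact (Submodule.Quotient.mk_eq_zero _).2 ((hK a).2 h)

lemma mapQ_mulLeft_self {I : Ideal R} (z : R) (hK : ∀ a, a ∈ I ↔ z * a ∈ I) :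
    Submodule.mapQ I I (LinearMap.mulLeft R z) (fun a ha => (hK a).1 ha) =
      z • (LinearMap.id : (R ⧸ I) →ₗ[R] (R ⧸ I)) := by
  ext
  rfl

/-- The diagonal map `R ⧸ (I ⊓ K) → R ⧸ I × R ⧸ K`. -/
def mvDiag (I K : Ideal R) : (R ⧸ I ⊓ K) →ₗ[R] (R ⧸ I) × (R ⧸ K) :=
  LinearMap.prod (Submodule.factor inf_le_left) (Submodule.factor inf_le_right)

/-- The difference map `R ⧸ I × R ⧸ K → R ⧸ (I ⊔ K)`. -/
def mvDiff (I K : Ideal R) : ((R ⧸ I) × (R ⧸ K)) →ₗ[R] (R ⧸ I ⊔ K) :=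
  LinearMap.coprod (Submodule.factor le_sup_left) (-Submodule.factor le_sup_right)

lemma mvDiag_injective (I K : Ideal R) : Function.Injective (mvDiag I K) := by
  refine (injective_iff_map_eq_zero _).2 fun x hx => ?_
  obtain ⟨a, rfl⟩ := Submodule.Quotient.mk_surjective _ x
  have h1 : a ∈ I := (Submodule.Quotient.mk_eq_zero _).1 (congrArg Prod.fst hx)
  have h2 : a ∈ K := (Submodule.Quotient.mk_eq_zero _).1 (congrArg Prod.snd hx)
  exact (Submodule.Quotient.mk_eq_zero _).2 ⟨h1, h2⟩

lemma mvDiff_mk (I K : Ideal R) (a b : R) :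
    mvDiff I K (Submodule.Quotient.mk a, Submodule.Quotient.mk b) =
      Submodule.Quotient.mk (a - b) := by
  rw [Submodule.Quotient.mk_sub, sub_eq_add_neg]
  rfl

lemma mvDiff_surjective (I K : Ideal R) : Function.Surjective (mvDiff I K) := by
  intro x
  obtain ⟨a, rfl⟩ := Submodule.Quotient.mk_surjective _ x
  refine ⟨(Submodule.Quotient.mk a, Submodule.Quotient.mk 0), ?_⟩
  rw [mvDiff_mk, sub_zero]

lemma mv_exact (I K : Ideal R) : Function.Exact (mvDiag I K) (mvDiff I K) := by
  rintro ⟨x, y⟩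
  obtain ⟨a, rfl⟩ := Submodule.Quotient.mk_surjective _ x
  obtain ⟨b, rfl⟩ := Submodule.Quotient.mk_surjective _ y
  rw [mvDiff_mk, Submodule.Quotient.mk_eq_zero]
  constructor
  · intro h
    obtain ⟨c, hc, d, hd, e⟩ := Submodule.mem_sup.1 h
    refine ⟨Submodule.Quotient.mk (a - c), Prod.ext ?_ ?_⟩
    · refine (Submodule.Quotient.eq _).2 ?_
      simpa using hc
    · refine (Submodule.Quotient.eq _).2 ?_
      have : a - c - b = d := by rw [← add_sub_cancel_left c d, e]; ring
      exact this.symm ▸ hd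
  · rintro ⟨z, hz⟩
    obtain ⟨c, rfl⟩ := Submodule.Quotient.mk_surjective _ z
    have h1 : c - a ∈ I := (Submodule.Quotient.eq _).1 (congrArg Prod.fst hz)
    have h2 : c - b ∈ K := (Submodule.Quotient.eq _).1 (congrArg Prod.snd hz)
    have : a - b = -(c - a) + (c - b) := by ring
    rw [this]
    exact Submodule.add_mem_sup (neg_mem h1) h2

lemma ExtVanish.prod {M N : Type} [AddCommGroup M] [AddCommGroup N] [Module R M] [Module R N]
    {d : ℕ} (h : ExtVanish J d M) (h' : ExtVanish J d N) : ExtVanish J d (M × N) :=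
  ExtVanish.middle (f := LinearMap.inl R M N) (g := LinearMap.snd R M N)
    Function.Exact.inl_snd LinearMap.inl_injective LinearMap.snd_surjective h h'

end IdealSequences

section MonomialIdeals

variable (k : Type) [Field k] {V : Type}

/-- The monomial ideal spanned by the monomials with exponent in `A`. -/
def monIdeal (A : Set (V →₀ ℕ)) : Ideal (MvPolynomial V k) :=
  Ideal.span ((fun s => monomial s (1 : k)) '' A)

/-- The quotient by a monomial ideal. -/
abbrev monQuot (A : Set (V →₀ ℕ)) : Type := MvPolynomial V k ⧸ monIdeal k A

variable {k} {A B : Set (V →₀ ℕ)}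

lemma mem_monIdeal (hA : IsUpperSet A) {p : MvPolynomial V k} :
    p ∈ monIdeal k A ↔ ∀ α ∈ p.support, α ∈ A := by
  rw [monIdeal, mem_ideal_span_monomial_image]
  exact ⟨fun h α hα => let ⟨_, hβ, hle⟩ := h α hα; hA hle hβ, fun h α hα => ⟨α, h α hα, le_rfl⟩⟩

lemma monomial_mem_monIdeal (hA : IsUpperSet A) {α : V →₀ ℕ} :
    monomial α (1 : k) ∈ monIdeal k A ↔ α ∈ A := by
  classical
  rw [mem_monIdeal hA, support_monomial, if_neg one_ne_zero]
  simp

lemma monIdeal_union : monIdeal k (A ∪ B) = monIdeal k A ⊔ monIdeal k B := by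
  rw [monIdeal, Set.image_union, Ideal.span_union]
  rfl

lemma monIdeal_inter (hA : IsUpperSet A) (hB : IsUpperSet B) :
    monIdeal k (A ∩ B) = monIdeal k A ⊓ monIdeal k B := by
  ext p
  rw [Ideal.mem_inf, mem_monIdeal hA, mem_monIdeal hB, mem_monIdeal (hA.inter hB)]
  simp only [Set.mem_inter_iff, forall_and]

lemma monIdeal_Ici (β : V →₀ ℕ) : monIdeal k (Set.Ici β) = Ideal.span {monomial β (1 : k)} := by
  apply le_antisymm
  · rw [monIdeal, Ideal.span_le]
    rintro _ ⟨α, hα, rfl⟩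
    refine Ideal.mem_span_singleton'.2 ⟨monomial (α - β) 1, ?_⟩
    rw [monomial_mul, one_mul, tsub_add_cancel_of_le hα]
  · rw [Ideal.span_le, Set.singleton_subset_iff]
    exact Ideal.subset_span ⟨β, Set.mem_Ici.2 le_rfl, rfl⟩

lemma isUpperSet_colon (hA : IsUpperSet A) (β : V →₀ ℕ) : IsUpperSet {α | β + α ∈ A} :=
  fun _ _ h h' => hA (add_le_add_right h _) h'

lemma mem_monIdeal_colon (hA : IsUpperSet A) (β : V →₀ ℕ) (p : MvPolynomial V k) :
    p ∈ monIdeal k {α | β + α ∈ A} ↔ monomial β 1 * p ∈ monIdeal k A := by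
  classical
  rw [mem_monIdeal (isUpperSet_colon hA β), mem_monIdeal hA]
  constructor
  · intro h α hα
    rw [mem_support_iff, coeff_monomial_mul', one_mul] at hα
    have hle : β ≤ α := by
      by_contra hle
      simp [hle] at hα
    rw [if_pos hle] at hα
    have := h _ (mem_support_iff.2 hα)
    rwa [Set.mem_ofPred_eq, add_tsub_cancel_of_le hle] at this
  · intro h α hα
    refine h _ ?_
    rw [mem_support_iff, coeff_monomial_mul, one_mul]
    exact mem_support_iff.1 hα

lemma monIdeal_mono (h : A ⊆ B) : monIdeal k A ≤ monIdeal k B :=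
  Ideal.span_mono (Set.image_mono h)

variable (k) in
/-- Vanishing of the local cohomology of a monomial quotient in degrees below `d`. -/
def MonVanish (d : ℕ) (A : Set (V →₀ ℕ)) : Prop :=
  ExtVanish (maxIdeal k V) d (monQuot k A)

variable (k) in
/-- The monomial with exponent `γ` kills the local cohomology in degree `i`. -/
def MonKill (γ : V →₀ ℕ) (i : ℕ) (A : Set (V →₀ ℕ)) : Prop :=
  ExtKill (maxIdeal k V) (monomial γ 1) i (monQuot k A)

lemma monomial_mem_maxIdeal {α : V →₀ ℕ} (hα : α ≠ 0) :
    monomial α (1 : k) ∈ maxIdeal k V := by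
  obtain ⟨v, hv⟩ := Finsupp.ne_iff.1 hα
  have hle : Finsupp.single v 1 ≤ α := Finsupp.single_le_iff.2 (Nat.one_le_iff_ne_zero.2 hv)
  have : monomial α (1 : k) = monomial (α - Finsupp.single v 1) 1 * X v := by
    rw [X, monomial_mul, one_mul, tsub_add_cancel_of_le hle]
  rw [this]
  exact Ideal.mul_mem_left _ _ (Ideal.subset_span ⟨v, rfl⟩)

lemma MonVanish.colon {d : ℕ} (hA : IsUpperSet A) (β : V →₀ ℕ)
    (h : MonVanish k d {α | β + α ∈ A}) (h' : MonVanish k d (A ∪ Set.Ici β)) :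
    MonVanish k d A :=
  ExtVanish.middle (exact_colon _ (mem_monIdeal_colon hA β)
    (by rw [monIdeal_union, monIdeal_Ici])) (mapQ_mulLeft_injective _ (mem_monIdeal_colon hA β))
    (Submodule.factor_surjective _) h h'

lemma colon_eq_self (hA : IsUpperSet A) {β : V →₀ ℕ} (hβ : ∀ α, β + α ∈ A → α ∈ A) :
    {α | β + α ∈ A} = A :=
  Set.Subset.antisymm hβ fun _ h => hA le_add_self h

lemma exact_regular (hA : IsUpperSet A) {β : V →₀ ℕ} (hβ : ∀ α, β + α ∈ A → α ∈ A) :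
    Function.Exact (monomial β (1 : k) • (LinearMap.id : monQuot k A →ₗ[MvPolynomial V k] monQuot k A))
      (Submodule.factor (monIdeal_mono Set.subset_union_left :
        monIdeal k A ≤ monIdeal k (A ∪ Set.Ici β))) := by
  have hK : ∀ a, a ∈ monIdeal k A ↔ monomial β 1 * a ∈ monIdeal k A := by
    intro a
    rw [← mem_monIdeal_colon hA, colon_eq_self hA hβ]
  have := exact_colon (L := monIdeal k (A ∪ Set.Ici β)) _ hK (by rw [monIdeal_union, monIdeal_Ici])
  rwa [mapQ_mulLeft_self _ hK] at this

lemma injective_regular (hA : IsUpperSet A) {β : V →₀ ℕ} (hβ : ∀ α, β + α ∈ A → α ∈ A) :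
    Function.Injective
      (monomial β (1 : k) • (LinearMap.id : monQuot k A →ₗ[MvPolynomial V k] monQuot k A)) := by
  have hK : ∀ a, a ∈ monIdeal k A ↔ monomial β 1 * a ∈ monIdeal k A := by
    intro a
    rw [← mem_monIdeal_colon hA, colon_eq_self hA hβ]
  have := mapQ_mulLeft_injective _ hK
  rwa [mapQ_mulLeft_self _ hK] at this

lemma MonVanish.regular {d : ℕ} (hA : IsUpperSet A) {β : V →₀ ℕ} (hβ0 : β ≠ 0)
    (hβ : ∀ α, β + α ∈ A → α ∈ A) (h : MonVanish k d (A ∪ Set.Ici β)) :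
    MonVanish k (d + 1) A :=
  ExtVanish.of_regular (monomial_mem_maxIdeal hβ0)
    (fun x hx => (injective_iff_map_eq_zero _).1 (injective_regular hA hβ) x hx)
    (exact_regular hA hβ) (Submodule.factor_surjective _) h

lemma MonKill.regular {i : ℕ} {γ δ : V →₀ ℕ} (hA : IsUpperSet A) {β : V →₀ ℕ}
    (hβ : ∀ α, β + α ∈ A → α ∈ A) (h : MonKill k γ i A) (h' : MonKill k δ (i + 1) A) :
    MonKill k (γ + δ) i (A ∪ Set.Ici β) := by
  have := ExtKill.right (exact_regular hA hβ) (injective_regular hA hβ)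
    (Submodule.factor_surjective _) h h'
  rwa [monomial_mul, one_mul] at this

lemma MonKill.mono {i : ℕ} {γ δ : V →₀ ℕ} (hle : γ ≤ δ) (h : MonKill k γ i A) :
    MonKill k δ i A := by
  have := ExtKill.mul_left h (monomial (δ - γ) 1)
  rwa [monomial_mul, one_mul, tsub_add_cancel_of_le hle] at this

lemma MonKill.colon {i : ℕ} {γ : V →₀ ℕ} (hA : IsUpperSet A) (β : V →₀ ℕ)
    (h : MonKill k γ i A) : MonKill k (β + γ) i {α | β + α ∈ A} := by
  have := ExtKill.of_comp (w := monomial β (1 : k))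
    (Submodule.mapQ (monIdeal k {α | β + α ∈ A}) (monIdeal k A)
      (LinearMap.mulLeft _ (monomial β (1 : k))) fun a ha => (mem_monIdeal_colon hA β a).1 ha)
    (Submodule.factor (monIdeal_mono fun α hα => hA le_add_self hα)) (by ext; rfl) h
  rwa [monomial_mul, one_mul] at this

lemma MonVanish.inter {d : ℕ} (hA : IsUpperSet A) (hB : IsUpperSet B)
    (h : MonVanish k (d + 1) A) (h' : MonVanish k (d + 1) B) (h'' : MonVanish k d (A ∪ B)) :
    MonVanish k (d + 1) (A ∩ B) := by
  unfold MonVanish monQuot at *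
  rw [monIdeal_inter hA hB]
  rw [monIdeal_union] at h''
  exact ExtVanish.left (mv_exact _ _) (mvDiag_injective _ _) (mvDiff_surjective _ _) (h.prod h') h''

lemma isUpperSet_union_Ici (hA : IsUpperSet A) (β : V →₀ ℕ) : IsUpperSet (A ∪ Set.Ici β) :=
  hA.union (isUpperSet_Ici β)

lemma MonVanish.of_free (W : Finset V) : ∀ (A : Set (V →₀ ℕ)) (_ : IsUpperSet A)
    (_ : ∀ w ∈ W, ∀ α, Finsupp.single w 1 + α ∈ A → α ∈ A), MonVanish k W.card A := by
  classical
  induction W using Finset.induction_on with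
  | empty => exact fun A _ _ => ExtVanish.zero
  | insert w W hw ih =>
    intro A hA h
    rw [Finset.card_insert_of_notMem hw]
    refine MonVanish.regular hA (β := Finsupp.single w 1) (by simp)
      (h w (Finset.mem_insert_self _ _)) (ih _ (isUpperSet_union_Ici hA _) ?_)
    rintro v hv α (hα | hα)
    · exact Or.inl (h v (Finset.mem_insert_of_mem hv) α hα)
    · right
      have hne : v ≠ w := fun e => hw (e ▸ hv)
      simpa [Set.mem_Ici, Finsupp.single_le_iff, hne] using hα

section Torsion

lemma exists_torsion [Finite V] (hA : IsUpperSet A) {β : V →₀ ℕ}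
    (h : ∀ v, ∃ K : ℕ, β + Finsupp.single v K ∈ A) :
    ∃ r : ℕ, ∀ a ∈ maxIdeal k V ^ r,
      a • (Submodule.Quotient.mk (monomial β 1) : monQuot k A) = 0 := by
  have hfg : (maxIdeal k V).FG := Submodule.fg_span (Set.finite_range _)
  have hrad : maxIdeal k V ≤ (monIdeal k {α | β + α ∈ A}).radical := by
    rw [maxIdeal, Ideal.span_le]
    rintro _ ⟨v, rfl⟩
    obtain ⟨K, hK⟩ := h v
    refine ⟨K, ?_⟩
    rw [X_pow_eq_monomial, monomial_mem_monIdeal (isUpperSet_colon hA β)]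
    exact hK
  obtain ⟨r, hr⟩ := Ideal.exists_pow_le_of_le_radical_of_fg hrad hfg
  refine ⟨r, fun a ha => ?_⟩
  rw [← Submodule.Quotient.mk_smul, Submodule.Quotient.mk_eq_zero, smul_eq_mul, mul_comm,
    ← mem_monIdeal_colon hA]
  exact hr ha

lemma smul_monomial_eq_zero_iff (hA : IsUpperSet A) {β γ : V →₀ ℕ} :
    monomial γ (1 : k) • (Submodule.Quotient.mk (monomial β 1) : monQuot k A) = 0 ↔
      γ + β ∈ A := by
  rw [← Submodule.Quotient.mk_smul, Submodule.Quotient.mk_eq_zero, smul_eq_mul, monomial_mul,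
    one_mul, monomial_mem_monIdeal hA]

lemma MonKill.add_mem_of_zero [Finite V] (hA : IsUpperSet A) {β γ : V →₀ ℕ}
    (hk : MonKill k γ 0 A) (h : ∀ v, ∃ K : ℕ, β + Finsupp.single v K ∈ A) : γ + β ∈ A := by
  obtain ⟨r, hr⟩ := exists_torsion (k := k) hA h
  exact (smul_monomial_eq_zero_iff hA).1 (smul_eq_zero_of_extKill_zero hk r _ hr)

lemma MonKill.add_mem_of_one [Finite V] (hA : IsUpperSet A) (hB : IsUpperSet B) {β γ : V →₀ ℕ}
    (hvA : MonVanish k 1 A) (hvB : MonVanish k 1 B)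
    (hk : MonKill k γ 1 (A ∩ B)) (h : ∀ v, ∃ K : ℕ, β + Finsupp.single v K ∈ A ∪ B) :
    γ + β ∈ A ∪ B := by
  obtain ⟨r, hr⟩ := exists_torsion (k := k) (hA.union hB) h
  unfold MonKill monQuot at hk
  rw [monIdeal_inter hA hB] at hk
  rw [← smul_monomial_eq_zero_iff (k := k) (hA.union hB)]
  rw [monIdeal_union] at hr ⊢
  exact smul_eq_zero_of_extKill_one (mv_exact _ _) (mvDiag_injective _ _) (mvDiff_surjective _ _)
    (hvA.prod hvB) hk r _ hr

lemma extSurj_zero_of_socle (hA : IsUpperSet A)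
    (H : ∀ α, (∀ v, ∃ K : ℕ, α + Finsupp.single v K ∈ A) → ∀ v, α + Finsupp.single v 1 ∈ A) :
    ExtSurj (maxIdeal k V) 0 (ModuleCat.of _ (monQuot k A)) := by
  refine extSurj_zero_of_torsion fun r q hq a ha => ?_
  obtain ⟨p, rfl⟩ := Submodule.Quotient.mk_surjective _ q
  have hp : ∀ α ∈ p.support, ∀ v, Finsupp.single v 1 + α ∈ A := by
    intro α hα v
    rw [add_comm]
    refine H α (fun w => ⟨r, ?_⟩) v
    have h1 := hq (X w ^ r) (Ideal.pow_mem_pow (I := maxIdeal k V) (Ideal.subset_span (Set.mem_range_self w)) r)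
    rw [← Submodule.Quotient.mk_smul, Submodule.Quotient.mk_eq_zero, smul_eq_mul,
      X_pow_eq_monomial, ← mem_monIdeal_colon hA, mem_monIdeal (isUpperSet_colon hA _)] at h1
    rw [add_comm]
    exact h1 α hα
  have hle : maxIdeal k V ≤ (monIdeal k A).colon {p} := by
    rw [maxIdeal, Ideal.span_le]
    rintro _ ⟨v, rfl⟩
    rw [SetLike.mem_coe, Submodule.mem_colon_singleton, smul_eq_mul, X, ← mem_monIdeal_colon hA,
      mem_monIdeal (isUpperSet_colon hA _)]
    exact fun α hα => hp α hα v
  have := hle ha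
  rw [Submodule.mem_colon_singleton] at this
  exact (Submodule.Quotient.mk_eq_zero _).2 this

end Torsion

lemma extSurj_one_inter (hA : IsUpperSet A) (hB : IsUpperSet B) (h : MonVanish k 2 A)
    (h' : MonVanish k 2 B)
    (h'' : ExtSurj (maxIdeal k V) 0 (ModuleCat.of _ (monQuot k (A ∪ B)))) :
    ExtSurj (maxIdeal k V) 1 (ModuleCat.of _ (monQuot k (A ∩ B))) := by
  unfold MonVanish monQuot at *
  rw [monIdeal_inter hA hB]
  rw [monIdeal_union] at h''
  exact ExtSurj.succ (mv_exact _ _) (mvDiag_injective _ _) (mvDiff_surjective _ _)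
    (h.prod h') h''

end MonomialIdeals

section Exponents

variable {V : Type}

/-- The degree of an exponent in the variables of `s`. -/
def wt (s : Finset V) (α : V →₀ ℕ) : ℕ := ∑ j ∈ s, α j

lemma wt_add (s : Finset V) (α β : V →₀ ℕ) : wt s (α + β) = wt s α + wt s β :=
  Finset.sum_add_distrib

lemma wt_mono (s : Finset V) {α β : V →₀ ℕ} (h : α ≤ β) : wt s α ≤ wt s β :=
  Finset.sum_le_sum fun j _ => h j

lemma wt_single [DecidableEq V] (s : Finset V) (v : V) (K : ℕ) :
    wt s (Finsupp.single v K) = if v ∈ s then K else 0 := by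
  simp [wt, Finsupp.single_apply]

lemma exists_mem_of_wt_pos {s : Finset V} {α : V →₀ ℕ} (h : 1 ≤ wt s α) :
    ∃ v ∈ s, Finsupp.single v 1 ≤ α := by
  by_contra! hc
  have : wt s α = 0 := Finset.sum_eq_zero fun v hv => by
    have := hc v hv
    rw [Finsupp.single_le_iff] at this
    omega
  omega

lemma exists_mem_of_two_le_wt {s : Finset V} {α : V →₀ ℕ} (h : 2 ≤ wt s α) :
    ∃ v ∈ s, ∃ w ∈ s, Finsupp.single v 1 + Finsupp.single w 1 ≤ α := by
  classical
  obtain ⟨v, hv, hle⟩ := exists_mem_of_wt_pos (by omega : 1 ≤ wt s α)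
  have h1 : wt s (α - Finsupp.single v 1) + wt s (Finsupp.single v 1) = wt s α := by
    rw [← wt_add, tsub_add_cancel_of_le hle]
  rw [wt_single, if_pos hv] at h1
  obtain ⟨w, hw, hle'⟩ := exists_mem_of_wt_pos (by omega : 1 ≤ wt s (α - Finsupp.single v 1))
  exact ⟨v, hv, w, hw, by rw [add_comm]; exact (le_tsub_iff_right hle).1 hle'⟩

lemma isUpperSet_two_le_wt (s : Finset V) : IsUpperSet {α | 2 ≤ wt s α} :=
  fun _ _ h h' => le_trans h' (wt_mono s h)

variable [Fintype V] [DecidableEq V]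

/-- The exponents of the monomials in the second symbolic power. -/
def symExp (Δ : Set (Finset V)) : Set (V →₀ ℕ) := {α | ∀ F ∈ facets Δ, 2 ≤ wt Fᶜ α}

lemma isUpperSet_symExp (Δ : Set (Finset V)) : IsUpperSet (symExp Δ) :=
  fun _ _ h h' F hF => isUpperSet_two_le_wt _ h (h' F hF)

variable (k : Type) [Field k]

lemma facePrime_sq (F : Finset V) : facePrime k F ^ 2 = monIdeal k {α | 2 ≤ wt Fᶜ α} := by
  rw [sq, facePrime, Ideal.span_mul_span']
  apply le_antisymm
  · rw [Ideal.span_le]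
    rintro _ ⟨_, ⟨i, hi, rfl⟩, _, ⟨j, hj, rfl⟩, rfl⟩
    change X i * X j ∈ monIdeal k _
    rw [X, X, monomial_mul, one_mul, monomial_mem_monIdeal (isUpperSet_two_le_wt _)]
    change 2 ≤ wt _ _
    rw [wt_add, wt_single, wt_single, if_pos (Finset.mem_compl.2 hi), if_pos (Finset.mem_compl.2 hj)]
  · rw [monIdeal, Ideal.span_le]
    rintro _ ⟨α, hα, rfl⟩
    obtain ⟨v, hv, w, hw, hle⟩ := exists_mem_of_two_le_wt hα
    have : monomial α (1 : k) =
        monomial (α - (Finsupp.single v 1 + Finsupp.single w 1)) 1 * (X v * X w) := by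
      rw [X, X, monomial_mul, monomial_mul, one_mul, one_mul, tsub_add_cancel_of_le hle]
    change monomial α (1 : k) ∈ Ideal.span _
    rw [this]
    exact Ideal.mul_mem_left _ _ (Ideal.subset_span ⟨_, ⟨v, Finset.mem_compl.1 hv, rfl⟩, _,
      ⟨w, Finset.mem_compl.1 hw, rfl⟩, rfl⟩)

lemma symbolicPower_eq (Δ : Set (Finset V)) : symbolicPower k Δ 2 = monIdeal k (symExp Δ) := by
  ext p
  simp only [symbolicPower, Ideal.mem_iInf, facePrime_sq, mem_monIdeal (isUpperSet_two_le_wt _),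
    mem_monIdeal (isUpperSet_symExp Δ)]
  exact ⟨fun h α hα F hF => h F hF α hα, fun h F hF α hα => h α hα F hF⟩

end Exponents

section Dimension

variable {V : Type} (k : Type) [Field k]

/-- Evaluation onto the polynomial ring in the variables of a face. -/
def faceEval (F : Finset V) : MvPolynomial V k →ₐ[k] MvPolynomial F k :=
  open Classical in aeval fun v => if h : v ∈ F then X ⟨v, h⟩ else 0

/-- Inclusion of the polynomial ring in the variables of a face. -/
def faceIncl (F : Finset V) : MvPolynomial F k →ₐ[k] MvPolynomial V k := rename Subtype.val

lemma faceEval_faceIncl (F : Finset V) (p : MvPolynomial F k) :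
    faceEval k F (faceIncl k F p) = p := by
  rw [faceEval, faceIncl, aeval_rename]
  convert aeval_X_left_apply p
  exact funext fun v => dif_pos v.2

lemma facePrime_le_ker (F : Finset V) : facePrime k F ≤ RingHom.ker (faceEval k F) := by
  rw [facePrime, Ideal.span_le]
  rintro _ ⟨v, hv, rfl⟩
  have hv' : v ∉ F := hv
  simp [faceEval, hv']

lemma mk_comp_faceIncl_surjective (F : Finset V) : Function.Surjective
    ((Ideal.Quotient.mk (facePrime k F)).comp (faceIncl k F).toRingHom) := by
  intro x
  obtain ⟨p, rfl⟩ := Ideal.Quotient.mk_surjective x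
  induction p using MvPolynomial.induction_on with
  | C a => exact ⟨C a, by simp [faceIncl]⟩
  | add p q hp hq =>
    obtain ⟨a, ha⟩ := hp
    obtain ⟨b, hb⟩ := hq
    exact ⟨a + b, by rw [map_add, ha, hb, map_add]⟩
  | mul_X p v hp =>
    obtain ⟨a, ha⟩ := hp
    by_cases hv : v ∈ F
    · exact ⟨a * X ⟨v, hv⟩, by rw [map_mul, ha, map_mul]; simp [faceIncl]⟩
    · refine ⟨0, ?_⟩
      have : Ideal.Quotient.mk (facePrime k F) (X v) = 0 :=
        Ideal.Quotient.eq_zero_iff_mem.2 (Ideal.subset_span ⟨v, hv, rfl⟩)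
      rw [map_zero, map_mul, this, mul_zero]

lemma ringKrullDim_face (F : Finset V) : ringKrullDim (MvPolynomial F k) = F.card := by
  rw [MvPolynomial.ringKrullDim_of_isNoetherianRing, ringKrullDim_eq_zero_of_field]
  simp

lemma card_le_ringKrullDim {Δ : Set (Finset V)} {F : Finset V} (hF : F ∈ facets Δ) :
    (F.card : WithBot (WithTop ℕ)) ≤ ringKrullDim (MvPolynomial V k ⧸ symbolicPower k Δ 2) := by
  have hle : symbolicPower k Δ 2 ≤ facePrime k F :=
    (iInf₂_le F hF).trans (Ideal.pow_le_self two_ne_zero)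
  have := ringKrullDim_le_of_surjective
    (Ideal.Quotient.lift (symbolicPower k Δ 2) (faceEval k F).toRingHom
      fun a ha => facePrime_le_ker k F (hle ha))
    (fun p => ⟨Ideal.Quotient.mk _ (faceIncl k F p), faceEval_faceIncl k F p⟩)
  rwa [ringKrullDim_face] at this

lemma ringKrullDim_le [Fintype V] {Δ : Set (Finset V)} {d : ℕ} (h : ∀ F ∈ facets Δ, F.card ≤ d) :
    ringKrullDim (MvPolynomial V k ⧸ symbolicPower k Δ 2) ≤ (d : WithBot (WithTop ℕ)) := by
  classical
  rw [ringKrullDim_quotient]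
  refine iSup_le fun p => ?_
  have hp : symbolicPower k Δ 2 ≤ (p.head : PrimeSpectrum _).asIdeal := p.head.2
  have hprime := (p.head : PrimeSpectrum (MvPolynomial V k)).isPrime
  have hinf : (Finset.univ.filter (· ∈ facets Δ)).inf (fun F => facePrime k F ^ 2) ≤
      (p.head : PrimeSpectrum _).asIdeal := by
    refine le_trans ?_ hp
    refine le_iInf₂ fun F hF => ?_
    exact Finset.inf_le (by simpa using hF)
  obtain ⟨F, hF, hle⟩ := hprime.inf_le'.1 hinf
  have hF' : F ∈ facets Δ := by simpa using hF
  replace hle := hprime.le_of_pow_le hle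
  let q : LTSeries (PrimeSpectrum.zeroLocus (facePrime k F : Set (MvPolynomial V k))) :=
    { length := p.length
      toFun := fun i => ⟨(p i).1, hle.trans (p.head_le i)⟩
      step := p.step }
  have h1 := Order.LTSeries.length_le_krullDim q
  rw [← ringKrullDim_quotient] at h1
  have h2 := ringKrullDim_le_of_surjective _ (mk_comp_faceIncl_surjective k F)
  rw [ringKrullDim_face] at h2
  refine (h1.trans h2).trans ?_
  exact Nat.mono_cast (α := WithBot ℕ∞) (h F hF')

end Dimension

section Facets

variable {V : Type} [Fintype V] [DecidableEq V] {k : Type} [Field k]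

lemma quotBuchsbaum_of_extSurj {Δ : Set (Finset V)} {d : ℕ} (hcard : ∀ F ∈ facets Δ, F.card ≤ d)
    (h : ∀ i < d, ExtSurj (maxIdeal k V) i (ModuleCat.of _ (monQuot k (symExp Δ)))) :
    quotBuchsbaum k V (symbolicPower k Δ 2) := by
  rw [quotBuchsbaum_iff]
  intro i hi
  have hlt : (i : WithBot ℕ∞) < d := lt_of_lt_of_le hi (ringKrullDim_le k hcard)
  rw [symbolicPower_eq]
  exact h i (Nat.cast_lt.1 hlt)

lemma monKill_of_quotBuchsbaum {Δ : Set (Finset V)} {F : Finset V} (hF : F ∈ facets Δ)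
    (h : quotBuchsbaum k V (symbolicPower k Δ 2)) {i : ℕ} (hi : i < F.card) {γ : V →₀ ℕ}
    (hγ : γ ≠ 0) : MonKill k γ i (symExp Δ) := by
  rw [quotBuchsbaum_iff] at h
  have hlt : (i : WithBot ℕ∞) < F.card := Nat.cast_lt.2 hi
  have := h i (lt_of_lt_of_le hlt (card_le_ringKrullDim k hF))
  rw [symbolicPower_eq] at this
  exact ExtSurj.extKill (monomial_mem_maxIdeal hγ) this

omit [DecidableEq V] in
lemma exists_facet_superset {Δ : Set (Finset V)} {F : Finset V} (hF : F ∈ Δ) :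
    ∃ H ∈ facets Δ, F ⊆ H := by
  obtain ⟨H, hle, hH⟩ := (Set.toFinite Δ).exists_le_maximal hF
  exact ⟨H, ⟨hH.1, fun K hK hHK => le_antisymm hHK (hH.2 hK hHK)⟩, hle⟩

omit [Fintype V] in
lemma mem_facets_indepComplex {G : SimpleGraph V} {F : Finset V} :
    F ∈ facets (indepComplex G) ↔
      (∀ u ∈ F, ∀ v ∈ F, ¬ G.Adj u v) ∧ ∀ v, v ∉ F → ∃ u ∈ F, G.Adj v u := by
  constructor
  · rintro ⟨h1, h2⟩
    refine ⟨h1, fun v hv => ?_⟩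
    by_contra! hc
    have hins : insert v F ∈ indepComplex G := by
      intro x hx y hy
      rcases Finset.mem_insert.1 hx with rfl | hx' <;> rcases Finset.mem_insert.1 hy with rfl | hy'
      · exact G.irrefl
      · exact hc y hy'
      · exact fun h => hc x hx' h.symm
      · exact h1 x hx' y hy'
    exact hv ((h2 _ hins (Finset.subset_insert _ _)).symm ▸ Finset.mem_insert_self v F)
  · rintro ⟨h1, h2⟩
    refine ⟨h1, fun H hH hFH => hFH.antisymm fun v hv => ?_⟩
    by_contra hvF
    obtain ⟨u, hu, huv⟩ := h2 v hvF
    exact hH v hv u (hFH hu) huv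

end Facets

section Matching

variable {V : Type} [Fintype V] [DecidableEq V] {k : Type} [Field k] {G : SimpleGraph V}
  {σ : V → V}

/-- Twice the number of matched pairs dividing a monomial, with multiplicity. -/
def pairWt (σ : V → V) (α : V →₀ ℕ) : ℕ := ∑ v, min (α v) (α (σ v))

omit [DecidableEq V] in
lemma pairWt_mono {α β : V →₀ ℕ} (h : α ≤ β) : pairWt σ α ≤ pairWt σ β :=
  Finset.sum_le_sum fun v _ => min_le_min (h v) (h (σ v))

/-- The exponents involving a variable of `T`, or of pair weight at least `c`. -/
def pairExp (σ : V → V) (T : Finset V) (c : ℕ) : Set (V →₀ ℕ) :=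
  {α | (∃ v ∈ T, 1 ≤ α v) ∨ c ≤ pairWt σ α}

omit [DecidableEq V] in
lemma isUpperSet_pairExp (T : Finset V) (c : ℕ) : IsUpperSet (pairExp σ T c) := by
  rintro α β h (⟨v, hv, h1⟩ | h1)
  · exact Or.inl ⟨v, hv, h1.trans (h v)⟩
  · exact Or.inr (h1.trans (pairWt_mono h))

section Involution

variable (hσ : ∀ v, σ (σ v) = v)
include hσ

lemma pairWt_eq_two_mul {F : Finset V} (hF : ∀ v, v ∈ F ↔ σ v ∉ F) (α : V →₀ ℕ) :
    pairWt σ α = 2 * ∑ v ∈ Fᶜ, min (α v) (α (σ v)) := by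
  have h : ∑ v ∈ F, min (α v) (α (σ v)) = ∑ v ∈ Fᶜ, min (α v) (α (σ v)) := by
    refine Finset.sum_nbij' σ σ ?_ ?_ (fun v _ => hσ v) (fun v _ => hσ v) ?_
    · intro v hv
      exact Finset.mem_compl.2 ((hF v).1 hv)
    · intro v hv
      rw [hF, hσ]
      exact Finset.mem_compl.1 hv
    · intro v _
      rw [hσ, min_comm]
  rw [pairWt, ← Finset.sum_add_sum_compl F, h, two_mul]

lemma two_mul_card_compl {F : Finset V} (hF : ∀ v, v ∈ F ↔ σ v ∉ F) :
    2 * Fᶜ.card = Fintype.card V := by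
  have h : F.card = Fᶜ.card := by
    refine Finset.card_nbij' σ σ ?_ ?_ (fun v _ => hσ v) (fun v _ => hσ v)
    · intro v hv
      exact Finset.mem_compl.2 ((hF v).1 hv)
    · intro v hv
      refine (hF _).2 ?_
      rw [hσ]
      exact Finset.mem_compl.1 hv
  rw [two_mul, ← Finset.card_add_card_compl F]
  omega

lemma pairWt_pair_add (v : V) (α : V →₀ ℕ) :
    pairWt σ (Finsupp.single v 1 + Finsupp.single (σ v) 1 + α) = 2 + pairWt σ α := by
  have h : ∀ u, min ((Finsupp.single v 1 + Finsupp.single (σ v) 1 + α : V →₀ ℕ) u)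
      ((Finsupp.single v 1 + Finsupp.single (σ v) 1 + α : V →₀ ℕ) (σ u)) =
      (if v = u then 1 else 0) + (if σ v = u then 1 else 0) + min (α u) (α (σ u)) := by
    intro u
    simp only [Finsupp.add_apply, Finsupp.single_apply]
    have h1 : v = σ u ↔ σ v = u := ⟨fun h => by rw [h, hσ], fun h => by rw [← h, hσ]⟩
    have h2 : σ v = σ u ↔ v = u := ⟨fun h => by rw [← hσ v, h, hσ], fun h => by rw [h]⟩
    simp only [h1, h2]
    omega
  unfold pairWt
  rw [Finset.sum_congr rfl fun u _ => h u, Finset.sum_add_distrib, Finset.sum_add_distrib]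
  simp

variable (hne : ∀ v, σ v ≠ v)
include hne

lemma pairWt_single_add {v : V} {α : V →₀ ℕ} (h0 : α (σ v) = 0) :
    pairWt σ (Finsupp.single v 1 + α) = pairWt σ α := by
  refine Finset.sum_congr rfl fun u _ => ?_
  simp only [Finsupp.add_apply, Finsupp.single_apply]
  by_cases h1 : v = u
  · subst h1
    simp [h0, (hne v).symm]
  · by_cases h2 : v = σ u
    · have : α u = 0 := by rw [← hσ u, ← h2, h0]
      simp [this, h1]
    · simp [h1, h2]

lemma two_le_pairWt {v : V} {α : V →₀ ℕ} (h1 : 1 ≤ α v) (h2 : 1 ≤ α (σ v)) :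
    2 ≤ pairWt σ α := by
  have hle : Finsupp.single v 1 + Finsupp.single (σ v) 1 + 0 ≤ α := by
    intro u
    have := hne v
    simp only [Finsupp.add_apply, Finsupp.single_apply, Finsupp.zero_apply]
    by_cases e1 : v = u
    · subst e1
      simpa [this] using h1
    · by_cases e2 : σ v = u
      · subst e2
        simpa [e1] using h2
      · simp [e1, e2]
  have := pairWt_mono (σ := σ) hle
  rw [pairWt_pair_add hσ] at this
  omega

lemma monVanish_pairExp {d : ℕ} (hd : 2 * d = Fintype.card V) : ∀ (m : ℕ) (T : Finset V)
    (_ : Tᶜ.card ≤ m) (_ : ∀ v ∈ T, σ v ∉ T),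
    MonVanish k d (pairExp σ T 2) ∧ MonVanish k d (pairExp σ T 4) := by
  intro m
  induction m with
  | zero =>
    intro T hT hind
    have hT : T = Finset.univ := by simpa using hT
    subst hT
    rcases isEmpty_or_nonempty V with hV | ⟨⟨v⟩⟩
    · have : d = 0 := by
        have := Fintype.card_eq_zero (α := V)
        omega
      subst this
      exact ⟨ExtVanish.zero, ExtVanish.zero⟩
    · exact absurd (Finset.mem_univ _) (hind v (Finset.mem_univ v))
  | succ m ih =>
    intro T hT hind
    by_cases hres : ∀ v, v ∈ T ∨ σ v ∈ T
    · have hF : ∀ v, v ∈ T ↔ σ v ∉ T := fun v => ⟨hind v, fun h => (hres v).resolve_right h⟩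
      have hcard := two_mul_card_compl hσ hF
      have hd' : d = Tᶜ.card := by omega
      have key : ∀ c, 0 < c → MonVanish k d (pairExp σ T c) := by
        intro c hc
        rw [hd']
        refine MonVanish.of_free _ _ (isUpperSet_pairExp T c) fun w hw α hα => ?_
        have hw' : w ∉ T := Finset.mem_compl.1 hw
        left
        by_contra! hcon
        have hz : ∀ v ∈ T, (Finsupp.single w 1 + α : V →₀ ℕ) v = 0 := by
          intro v hv
          have hne' : w ≠ v := fun e => hw' (e ▸ hv)
          have := hcon v hv
          simp only [Finsupp.add_apply, Finsupp.single_apply, if_neg hne']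
          omega
        rcases hα with ⟨v, hv, h1⟩ | h1
        · rw [hz v hv] at h1
          omega
        · have : pairWt σ (Finsupp.single w 1 + α) = 0 := by
            refine Finset.sum_eq_zero fun v _ => ?_
            rcases hres v with hv | hv
            · rw [hz v hv, Nat.zero_min]
            · rw [hz _ hv, Nat.min_zero]
          omega
      exact ⟨key 2 (by norm_num), key 4 (by norm_num)⟩
    · push Not at hres
      obtain ⟨v, hv, hv'⟩ := hres
      have hi1 : ∀ u ∈ insert v T, σ u ∉ insert v T := by
        intro u hu hu'
        rcases Finset.mem_insert.1 hu with rfl | hu <;> rcases Finset.mem_insert.1 hu' with e | hu'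
        · exact hne _ e
        · exact hv' hu'
        · exact hv' (by rw [← e, hσ]; exact hu)
        · exact hind u hu hu'
      have hi2 : ∀ u ∈ insert (σ v) T, σ u ∉ insert (σ v) T := by
        intro u hu hu'
        rcases Finset.mem_insert.1 hu with rfl | hu <;> rcases Finset.mem_insert.1 hu' with e | hu'
        · exact hne _ e
        · exact hv (by rwa [hσ] at hu')
        · exact hv (by rw [← hσ v, ← e, hσ]; exact hu)
        · exact hind u hu hu'
      have hc : ∀ u, u ∉ T → (insert u T)ᶜ.card ≤ m := by
        intro u hu
        have h1 := Finset.card_add_card_compl T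
        have h2 := Finset.card_add_card_compl (insert u T)
        rw [Finset.card_insert_of_notMem hu] at h2
        omega
      obtain ⟨a1, a2⟩ := ih _ (hc v hv) hi1
      obtain ⟨b1, b2⟩ := ih _ (hc _ hv') hi2
      have hsum : ∀ c, pairExp σ T c ∪ Set.Ici (Finsupp.single v 1) = pairExp σ (insert v T) c := by
        intro c
        ext α
        simp only [pairExp, Set.mem_union, Set.mem_ofPred_eq, Set.mem_Ici, Finsupp.single_le_iff,
          Finset.exists_mem_insert]
        constructor
        · rintro ((h | h) | h)
          · exact Or.inl (Or.inr h)
          · exact Or.inr h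
          · exact Or.inl (Or.inl h)
        · rintro ((h | h) | h)
          · exact Or.inr h
          · exact Or.inl (Or.inl h)
          · exact Or.inl (Or.inr h)
      have hT2 : MonVanish k d (pairExp σ T 2) := by
        refine MonVanish.colon (isUpperSet_pairExp _ _) (Finsupp.single v 1) ?_ ?_
        · convert b1 using 1
          ext α
          simp only [pairExp, Set.mem_ofPred_eq, Finset.exists_mem_insert]
          by_cases h0 : α (σ v) = 0
          · rw [pairWt_single_add hσ hne h0, h0]
            have : ∀ u ∈ T, (Finsupp.single v 1 + α : V →₀ ℕ) u = α u := by
              intro u hu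
              have : v ≠ u := fun e => hv (e ▸ hu)
              simp [this]
            constructor
            · rintro (⟨u, hu, h⟩ | h)
              · exact Or.inl (Or.inr ⟨u, hu, by rwa [this u hu] at h⟩)
              · exact Or.inr h
            · rintro ((h | ⟨u, hu, h⟩) | h)
              · omega
              · exact Or.inl ⟨u, hu, by rwa [this u hu]⟩
              · exact Or.inr h
          · refine iff_of_true (Or.inr (two_le_pairWt hσ hne (v := v) ?_ ?_))
              (Or.inl (Or.inl (by omega)))
            · simp
            · rw [Finsupp.add_apply]
              omega
        · rwa [hsum]
      refine ⟨hT2, ?_⟩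
      refine MonVanish.colon (isUpperSet_pairExp _ _)
        (Finsupp.single v 1 + Finsupp.single (σ v) 1) ?_ ?_
      · convert hT2 using 1
        ext α
        simp only [pairExp, Set.mem_ofPred_eq, pairWt_pair_add hσ]
        have : ∀ u ∈ T, (Finsupp.single v 1 + Finsupp.single (σ v) 1 + α : V →₀ ℕ) u = α u := by
          intro u hu
          have h1 : v ≠ u := fun e => hv (e ▸ hu)
          have h2 : σ v ≠ u := fun e => hv' (e ▸ hu)
          simp [h1, h2]
        have h3 : 4 ≤ 2 + pairWt σ α ↔ 2 ≤ pairWt σ α := by omega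
        rw [h3]
        refine or_congr_left ⟨?_, ?_⟩
        · rintro ⟨u, hu, h⟩
          exact ⟨u, hu, by rwa [this u hu] at h⟩
        · rintro ⟨u, hu, h⟩
          exact ⟨u, hu, by rwa [this u hu]⟩
      · refine MonVanish.colon (isUpperSet_union_Ici (isUpperSet_pairExp _ _) _)
          (Finsupp.single v 1) ?_ ?_
        · convert b2 using 1
          ext α
          have hIci : Finsupp.single v 1 + α ∈ Set.Ici (Finsupp.single v 1 + Finsupp.single (σ v) 1)
              ↔ 1 ≤ α (σ v) := by
            rw [Set.mem_Ici, add_le_add_iff_left, Finsupp.single_le_iff]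
          simp only [Set.mem_ofPred_eq, Set.mem_union, hIci]
          simp only [pairExp, Set.mem_ofPred_eq, Finset.exists_mem_insert]
          by_cases h0 : α (σ v) = 0
          · rw [pairWt_single_add hσ hne h0, h0]
            have : ∀ u ∈ T, (Finsupp.single v 1 + α : V →₀ ℕ) u = α u := by
              intro u hu
              have : v ≠ u := fun e => hv (e ▸ hu)
              simp [this]
            constructor
            · rintro ((⟨u, hu, h⟩ | h) | h)
              · exact Or.inl (Or.inr ⟨u, hu, by rwa [this u hu] at h⟩)
              · exact Or.inr h
              · omega
            · rintro ((h | ⟨u, hu, h⟩) | h)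
              · omega
              · exact Or.inl (Or.inl ⟨u, hu, by rwa [this u hu]⟩)
              · exact Or.inl (Or.inr h)
          · exact iff_of_true (Or.inr (by omega)) (Or.inl (Or.inl (by omega)))
        · rw [Set.union_assoc, Set.union_eq_self_of_subset_left (s := Set.Ici _) (t := Set.Ici _),
            hsum]
          · exact a2
          · exact Set.Ici_subset_Ici.2 le_self_add

end Involution

lemma quotBuchsbaum_of_matching (h : ∀ v : V, ∃! w, G.Adj v w) :
    quotBuchsbaum k V (symbolicPower k (indepComplex G) 2) := by
  choose σ hadj huniq using h
  have hσ : ∀ v, σ (σ v) = v := fun v => (huniq _ v (hadj v).symm).symm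
  have hne : ∀ v, σ v ≠ v := fun v => (hadj v).ne'
  have hG : ∀ v w, G.Adj v w ↔ w = σ v := fun v w => ⟨huniq v w, fun e => e ▸ hadj v⟩
  have hfac : ∀ F ∈ facets (indepComplex G), ∀ v, v ∈ F ↔ σ v ∉ F := by
    intro F hF v
    rw [mem_facets_indepComplex] at hF
    constructor
    · exact fun hv hv' => hF.1 v hv _ hv' (hadj v)
    · intro hv
      obtain ⟨u, hu, hvu⟩ := hF.2 _ hv
      rw [hG, hσ] at hvu
      exact hvu ▸ hu
  have hsym : symExp (indepComplex G) = pairExp σ ∅ 4 := by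
    ext α
    simp only [symExp, pairExp, Set.mem_ofPred_eq, Finset.notMem_empty, false_and, exists_false,
      false_or]
    constructor
    · intro h
      have hI : (Finset.univ.filter fun v => α (σ v) < α v) ∈ indepComplex G := by
        intro u hu v hv huv
        rw [hG] at huv
        subst huv
        simp only [Finset.mem_filter, hσ] at hu hv
        omega
      obtain ⟨F, hF, hle⟩ := exists_facet_superset hI
      rw [pairWt_eq_two_mul hσ (hfac F hF)]
      have := h F hF
      have h2 : wt Fᶜ α = ∑ v ∈ Fᶜ, min (α v) (α (σ v)) := by
        refine Finset.sum_congr rfl fun v hv => ?_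
        rw [min_eq_left]
        by_contra! hlt
        exact Finset.mem_compl.1 hv (hle (by simpa using hlt))
      omega
    · intro h F hF
      rw [pairWt_eq_two_mul hσ (hfac F hF)] at h
      have : ∑ v ∈ Fᶜ, min (α v) (α (σ v)) ≤ wt Fᶜ α :=
        Finset.sum_le_sum fun v _ => min_le_left _ _
      omega
  have hempty : (∅ : Finset V) ∈ indepComplex G := by
    intro u hu
    simp at hu
  obtain ⟨F₀, hF₀, -⟩ := exists_facet_superset hempty
  have hd := two_mul_card_compl hσ (hfac F₀ hF₀)
  refine quotBuchsbaum_of_extSurj (d := F₀ᶜ.card) ?_ ?_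
  · intro F hF
    have h1 := two_mul_card_compl hσ (hfac F hF)
    have h2 := Finset.card_add_card_compl F
    omega
  · intro i hi
    rw [hsym]
    exact ExtVanish.extSurj
      (monVanish_pairExp hσ hne hd _ ∅ le_rfl (fun v hv => by simp at hv)).2 hi

end Matching

section Path

variable {V : Type} {k : Type} [Field k]

/-- The exponents of degree at least two in a given pair of variables. -/
def twoExp (u v : V) : Set (V →₀ ℕ) := {α | 2 ≤ α u + α v}

lemma isUpperSet_twoExp (u v : V) : IsUpperSet (twoExp u v) :=
  fun _ _ h h' => le_trans h' (add_le_add (h u) (h v))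

lemma single_add_mem_twoExp {u v w : V} (hu : w ≠ u) (hv : w ≠ v) {α : V →₀ ℕ}
    (h : Finsupp.single w 1 + α ∈ twoExp u v) : α ∈ twoExp u v := by
  classical
  change 2 ≤ (Finsupp.single w 1 + α : V →₀ ℕ) u + (Finsupp.single w 1 + α : V →₀ ℕ) v at h
  simp only [Finsupp.add_apply, Finsupp.single_apply, hu, hv, if_false, zero_add] at h
  exact h

variable [Fintype V] [DecidableEq V] {G : SimpleGraph V} {a b c d : V}

omit [Fintype V] in
lemma subset_of_mem_indepComplex_path (huniv : ∀ v, v = a ∨ v = b ∨ v = c ∨ v = d)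
    (hab : G.Adj a b) (hbc : G.Adj b c) (hcd : G.Adj c d) {F : Finset V}
    (hF : F ∈ indepComplex G) : F ⊆ {b, d} ∨ F ⊆ {a, d} ∨ F ⊆ {a, c} := by
  by_cases hb : b ∈ F
  · refine Or.inl fun v hv => ?_
    rcases huniv v with rfl | rfl | rfl | rfl
    · exact absurd hab (hF _ hv _ hb)
    · simp
    · exact absurd hbc (hF _ hb _ hv)
    · simp
  · by_cases hc : c ∈ F
    · refine Or.inr (Or.inr fun v hv => ?_)
      rcases huniv v with rfl | rfl | rfl | rfl
      · simp
      · exact absurd hv hb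
      · simp
      · exact absurd hcd (hF _ hc _ hv)
    · refine Or.inr (Or.inl fun v hv => ?_)
      rcases huniv v with rfl | rfl | rfl | rfl
      · simp
      · exact absurd hv hb
      · exact absurd hv hc
      · simp

omit [Fintype V] in
lemma pair_mem_facets {u v : V} (h : ¬ G.Adj u v)
    (hmax : ∀ w, w = u ∨ w = v ∨ G.Adj w u ∨ G.Adj w v) :
    ({u, v} : Finset V) ∈ facets (indepComplex G) := by
  rw [mem_facets_indepComplex]
  constructor
  · intro x hx y hy hxy
    simp only [Finset.mem_insert, Finset.mem_singleton] at hx hy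
    rcases hx with rfl | rfl <;> rcases hy with rfl | rfl
    · exact G.irrefl hxy
    · exact h hxy
    · exact h hxy.symm
    · exact G.irrefl hxy
  · intro w hw
    simp only [Finset.mem_insert, Finset.mem_singleton, not_or] at hw
    rcases hmax w with h | h | h | h
    · exact absurd h hw.1
    · exact absurd h hw.2
    · exact ⟨u, by simp, h⟩
    · exact ⟨v, by simp, h⟩

lemma two_le_wt_compl {F : Finset V} {u v : V} (huv : u ≠ v) (hu : u ∉ F) (hv : v ∉ F)
    {α : V →₀ ℕ} (h : α ∈ twoExp u v) : 2 ≤ wt Fᶜ α := by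
  refine le_trans (b := ∑ j ∈ {u, v}, α j) ?_ (Finset.sum_le_sum_of_subset ?_)
  · rwa [Finset.sum_pair huv]
  · intro w hw
    simp only [Finset.mem_insert, Finset.mem_singleton] at hw
    rcases hw with rfl | rfl <;> rwa [Finset.mem_compl]

lemma mem_twoExp_of_two_le_wt_compl {F : Finset V} {u v : V} (huv : u ≠ v)
    (huniv : ∀ w, w ∈ F ∨ w = u ∨ w = v)
    {α : V →₀ ℕ} (h : 2 ≤ wt Fᶜ α) : α ∈ twoExp u v := by
  change 2 ≤ α u + α v
  rw [← Finset.sum_pair huv]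
  refine h.trans (Finset.sum_le_sum_of_subset fun w hw => ?_)
  simpa using (huniv w).resolve_left (Finset.mem_compl.1 hw)

lemma symExp_path (huniv : ∀ v, v = a ∨ v = b ∨ v = c ∨ v = d)
    (hab : G.Adj a b) (hbc : G.Adj b c) (hcd : G.Adj c d)
    (hac : ¬ G.Adj a c) (had : ¬ G.Adj a d) (hbd : ¬ G.Adj b d) :
    symExp (indepComplex G) = (twoExp b d ∩ twoExp b c) ∩ twoExp a c := by
  have hnac : a ≠ c := by rintro rfl; exact had hcd
  have hnbd : b ≠ d := by rintro rfl; exact had hab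
  have hnad : a ≠ d := by rintro rfl; exact hac hcd.symm
  ext α
  constructor
  · intro h
    refine ⟨⟨mem_twoExp_of_two_le_wt_compl hnbd ?_ (h {a, c} (pair_mem_facets hac ?_)),
      mem_twoExp_of_two_le_wt_compl hbc.ne ?_ (h {a, d} (pair_mem_facets had ?_))⟩,
      mem_twoExp_of_two_le_wt_compl hnac ?_ (h {b, d} (pair_mem_facets hbd ?_))⟩
    all_goals
      intro w
      rcases huniv w with rfl | rfl | rfl | rfl <;> simp [hab, hbc, hcd, hab.symm, hbc.symm,
        hcd.symm]
  · rintro ⟨⟨h1, h2⟩, h3⟩ F hF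
    rcases subset_of_mem_indepComplex_path huniv hab hbc hcd hF.1 with h | h | h
    · exact two_le_wt_compl hnac (fun hx => by simpa [hab.ne, hnad] using h hx)
        (fun hx => by simpa [hbc.ne', hcd.ne] using h hx) h3
    · exact two_le_wt_compl hbc.ne (fun hx => by simpa [hab.ne', hnbd] using h hx)
        (fun hx => by simpa [hnac.symm, hcd.ne] using h hx) h2
    · exact two_le_wt_compl hnbd (fun hx => by simpa [hab.ne', hbc.ne] using h hx)
        (fun hx => by simpa [hnad.symm, hcd.ne'] using h hx) h1

lemma quotBuchsbaum_of_path (huniv : ∀ v, v = a ∨ v = b ∨ v = c ∨ v = d)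
    (hab : G.Adj a b) (hbc : G.Adj b c) (hcd : G.Adj c d)
    (hac : ¬ G.Adj a c) (had : ¬ G.Adj a d) (hbd : ¬ G.Adj b d) :
    quotBuchsbaum k V (symbolicPower k (indepComplex G) 2) := by
  have hnac : a ≠ c := by rintro rfl; exact had hcd
  have hnad : a ≠ d := by rintro rfl; exact hac hcd.symm
  have hnbd : b ≠ d := by rintro rfl; exact had hab
  have e1 := hab.ne
  have e2 := hbc.ne
  have e3 := hcd.ne
  have free : ∀ x y u v : V, x ≠ y → x ≠ u → x ≠ v → y ≠ u → y ≠ v →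
      MonVanish k 2 (twoExp u v) := by
    intro x y u v hxy h1 h2 h3 h4
    rw [← Finset.card_pair hxy]
    refine MonVanish.of_free _ _ (isUpperSet_twoExp _ _) fun w hw α h => ?_
    rcases Finset.mem_insert.1 hw with rfl | hw
    · exact single_add_mem_twoExp h1 h2 h
    · rw [Finset.mem_singleton] at hw
      subst hw
      exact single_add_mem_twoExp h3 h4 h
  have hU := (isUpperSet_twoExp b d).inter (isUpperSet_twoExp b c)
  have hJ₁ : MonVanish k 2 (twoExp b d ∩ twoExp b c) := by
    refine MonVanish.inter (isUpperSet_twoExp _ _) (isUpperSet_twoExp _ _)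
      (free a c b d hnac e1 hnad e2.symm e3) (free a d b c hnad e1 hnac hnbd.symm e3.symm) ?_
    rw [← Finset.card_singleton a]
    refine MonVanish.of_free _ _ ((isUpperSet_twoExp _ _).union (isUpperSet_twoExp _ _))
      fun w hw α h => ?_
    rw [Finset.mem_singleton] at hw
    subst hw
    exact h.imp (single_add_mem_twoExp e1 hnad) (single_add_mem_twoExp e1 hnac)
  have hJ₂ : MonVanish k 2 (twoExp a c) := free b d a c hnbd e1.symm e2 hnad.symm e3.symm
  refine quotBuchsbaum_of_extSurj (d := 2) ?_ ?_
  · intro F hF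
    rcases subset_of_mem_indepComplex_path huniv hab hbc hcd hF.1 with h | h | h <;>
      exact (Finset.card_le_card h).trans Finset.card_le_two
  rw [symExp_path huniv hab hbc hcd hac had hbd]
  intro i hi
  interval_cases i
  · exact ExtVanish.extSurj (MonVanish.inter (d := 0) hU (isUpperSet_twoExp a c)
      (ExtVanish.mono hJ₁ one_le_two) (ExtVanish.mono hJ₂ one_le_two) ExtVanish.zero) one_pos
  · refine extSurj_one_inter hU (isUpperSet_twoExp a c) hJ₁ hJ₂ ?_
    refine extSurj_zero_of_socle (hU.union (isUpperSet_twoExp a c)) fun α h v => ?_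
    by_cases hα : α ∈ twoExp b d ∩ twoExp b c ∪ twoExp a c
    · exact (hU.union (isUpperSet_twoExp a c)) le_self_add hα
    have mem : ∀ β : V →₀ ℕ, β ∈ twoExp b d ∩ twoExp b c ∪ twoExp a c ↔
        (2 ≤ β b + β d ∧ 2 ≤ β b + β c) ∨ 2 ≤ β a + β c := fun _ => Iff.rfl
    rw [mem] at hα ⊢
    obtain ⟨K, hK⟩ := h d
    obtain ⟨L, hL⟩ := h a
    obtain ⟨M, hM⟩ := h b
    rw [mem] at hK hL hM
    simp only [Finsupp.add_apply, Finsupp.single_apply, hnac, hnad, hnbd, e1, e2, e1.symm,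
      e3.symm, hnad.symm, hnbd.symm, if_true, if_false] at hK hL hM ⊢
    rcases huniv v with rfl | rfl | rfl | rfl <;>
    simp only [hnac, hnad, hnbd, e1, e2, e3, e1.symm,
      e2.symm, e3.symm, hnac.symm, hnad.symm, hnbd.symm, if_true, if_false] <;> omega

lemma quotBuchsbaum_of_iso_pathGraph (e : G ≃g SimpleGraph.pathGraph 4) :
    quotBuchsbaum k V (symbolicPower k (indepComplex G) 2) := by
  have hadj : ∀ i j : Fin 4, G.Adj (e.symm i) (e.symm j) ↔ i.val + 1 = j.val ∨ j.val + 1 = i.val :=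
    fun i j => by rw [e.symm.map_adj_iff, SimpleGraph.pathGraph_adj]
  refine quotBuchsbaum_of_path (a := e.symm 0) (b := e.symm 1) (c := e.symm 2) (d := e.symm 3)
    (fun v => ?_) ?_ ?_ ?_ ?_ ?_ ?_
  · have h : ∀ i : Fin 4, i = 0 ∨ i = 1 ∨ i = 2 ∨ i = 3 := by decide
    rcases h (e v) with h | h | h | h <;> simp [← h]
  all_goals rw [hadj]; decide

end Path

section Cut

variable {V : Type} {k : Type} [Field k]

/-- The exponents of `A`, together with all exponents at least `K` in some variable of `T`. -/
def cutExp (A : Set (V →₀ ℕ)) (T : Finset V) (K : ℕ) : Set (V →₀ ℕ) := A ∪ {α | ∃ f ∈ T, K ≤ α f}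

lemma isUpperSet_cutExp {A : Set (V →₀ ℕ)} (hA : IsUpperSet A) (T : Finset V) (K : ℕ) :
    IsUpperSet (cutExp A T K) :=
  hA.union fun _ _ h ⟨f, hf, hle⟩ => ⟨f, hf, hle.trans (h f)⟩

lemma mem_of_single_add_mem {A : Set (V →₀ ℕ)} {f : V}
    (h : ∀ α, Finsupp.single f 1 + α ∈ A → α ∈ A) (K : ℕ) :
    ∀ α, Finsupp.single f K + α ∈ A → α ∈ A := by
  induction K with
  | zero => simp
  | succ K ih =>
    intro α hα
    refine ih α (h _ ?_)
    rwa [← add_assoc, ← Finsupp.single_add, add_comm 1 K]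

lemma single_add_mem_cutExp {A : Set (V →₀ ℕ)} {T : Finset V} {K : ℕ} {w : V} (hw : w ∉ T)
    (h : ∀ α, Finsupp.single w 1 + α ∈ A → α ∈ A) :
    ∀ α, Finsupp.single w 1 + α ∈ cutExp A T K → α ∈ cutExp A T K := by
  classical
  rintro α (hα | ⟨f, hf, hle⟩)
  · exact Or.inl (h α hα)
  · have hne : w ≠ f := fun e => hw (e ▸ hf)
    simp only [Finsupp.add_apply, Finsupp.single_apply, hne, if_false, zero_add] at hle
    exact Or.inr ⟨f, hf, hle⟩

lemma exists_monKill_cutExp {A : Set (V →₀ ℕ)} (hA : IsUpperSet A) {F : Finset V} {d : ℕ}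
    (hF : ∀ f ∈ F, ∀ α, Finsupp.single f 1 + α ∈ A → α ∈ A) {γ₀ : V →₀ ℕ}
    (hγ₀ : ∀ v ∉ F, γ₀ v = 0) (hk : ∀ i < d, MonKill k γ₀ i A) {T : Finset V} (hT : T ⊆ F) :
    ∀ i, i + T.card < d →
      ∃ γ : V →₀ ℕ, (∀ v ∉ F, γ v = 0) ∧ ∀ K, MonKill k γ i (cutExp A T K) := by
  classical
  induction T using Finset.induction_on with
  | empty =>
    intro i hi
    refine ⟨γ₀, hγ₀, fun K => ?_⟩
    have : cutExp A ∅ K = A := by simp [cutExp]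
    rw [this]
    exact hk i hi
  | insert f T hf ih =>
    intro i hi
    rw [Finset.card_insert_of_notMem hf] at hi
    have hT' := (Finset.subset_insert f T).trans hT
    obtain ⟨γ₁, h1, hk1⟩ := ih hT' i (by omega)
    obtain ⟨γ₂, h2, hk2⟩ := ih hT' (i + 1) (by omega)
    refine ⟨γ₁ + γ₂, fun v hv => by rw [Finsupp.add_apply, h1 v hv, h2 v hv], fun K => ?_⟩
    have := MonKill.regular (β := Finsupp.single f K) (isUpperSet_cutExp hA T K)
      (mem_of_single_add_mem (single_add_mem_cutExp hf
        (hF f (hT (Finset.mem_insert_self f T)))) K) (hk1 K) (hk2 K)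
    convert this using 1
    ext α
    simp only [cutExp, Finset.exists_mem_insert, Set.mem_union, Set.mem_ofPred_eq, Set.mem_Ici,
      Finsupp.single_le_iff]
    rw [or_assoc, or_comm (a := K ≤ α f)]

variable [Fintype V] [DecidableEq V]

/-- The exponents of degree at least two in the variables off each member of a family. -/
def famExp (E : Set (Finset V)) : Set (V →₀ ℕ) := {α | ∀ H ∈ E, 2 ≤ wt Hᶜ α}

lemma isUpperSet_famExp (E : Set (Finset V)) : IsUpperSet (famExp E) :=
  fun _ _ h h' H hH => isUpperSet_two_le_wt _ h (h' H hH)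

lemma famExp_union (E₁ E₂ : Set (Finset V)) : famExp (E₁ ∪ E₂) = famExp E₁ ∩ famExp E₂ := by
  ext α
  exact ⟨fun h => ⟨fun H hH => h H (Or.inl hH), fun H hH => h H (Or.inr hH)⟩,
    fun h H hH => hH.elim (h.1 H) (h.2 H)⟩

lemma cutExp_famExp_union (E₁ E₂ : Set (Finset V)) (F : Finset V) (K : ℕ) :
    cutExp (famExp (E₁ ∪ E₂)) F K = cutExp (famExp E₁) F K ∩ cutExp (famExp E₂) F K := by
  rw [famExp_union]
  exact Set.inter_union_distrib_right _ _ _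

lemma wt_compl_single_add {H : Finset V} {f : V} (hf : f ∈ H) (K : ℕ) (α : V →₀ ℕ) :
    wt Hᶜ (Finsupp.single f K + α) = wt Hᶜ α := by
  rw [wt_add, wt_single, if_neg (by simpa using hf), zero_add]

lemma wt_compl_eq_zero {F H : Finset V} (hFH : F ⊆ H) {γ : V →₀ ℕ} (hγ : ∀ v ∉ F, γ v = 0) :
    wt Hᶜ γ = 0 :=
  Finset.sum_eq_zero fun v hv => hγ v fun h => Finset.mem_compl.1 hv (hFH h)

lemma mem_famExp_of_single_add {E : Set (Finset V)} {f : V} (hf : ∀ H ∈ E, f ∈ H) {α : V →₀ ℕ}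
    (h : Finsupp.single f 1 + α ∈ famExp E) : α ∈ famExp E := by
  intro H hH
  have := h H hH
  rwa [wt_compl_single_add (hf H hH)] at this

lemma monVanish_cutExp_famExp [Nonempty V] {E : Set (Finset V)} {F : Finset V} {K : ℕ}
    (hE : ∀ H ∈ E, F ⊂ H) : MonVanish k 1 (cutExp (famExp E) F K) := by
  induction E, Set.toFinite E using Set.Finite.induction_on with
  | empty =>
    have : cutExp (famExp ∅) F K = (Set.univ : Set (V →₀ ℕ)) :=
      Set.eq_univ_of_forall fun α => Or.inl fun H hH => absurd hH (Set.notMem_empty H)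
    rw [this]
    exact MonVanish.of_free {Classical.arbitrary V} _ (fun _ _ _ _ => trivial) fun _ _ _ _ => trivial
  | @insert H E _ _ ih =>
    rw [Set.insert_eq, cutExp_famExp_union]
    refine MonVanish.inter (isUpperSet_cutExp (isUpperSet_famExp _) _ _)
      (isUpperSet_cutExp (isUpperSet_famExp _) _ _) ?_
      (ih fun H' hH' => hE H' (Set.mem_insert_of_mem _ hH')) ExtVanish.zero
    obtain ⟨w, hw, hwF⟩ := Finset.exists_of_ssubset (hE H (Set.mem_insert _ _))
    refine MonVanish.of_free {w} (cutExp (famExp {H}) F K)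
      (isUpperSet_cutExp (isUpperSet_famExp {H}) F K) fun w' hw' => ?_
    rw [Finset.mem_singleton] at hw'
    subst hw'
    refine single_add_mem_cutExp hwF fun α => mem_famExp_of_single_add fun H' hH' => ?_
    rw [Set.mem_singleton_iff] at hH'
    exact hH' ▸ hw

lemma MonKill.add_mem_famExp [Nonempty V] {E₁ E₂ : Set (Finset V)} {F : Finset V} {K : ℕ}
    {β γ : V →₀ ℕ} (h1 : ∀ H ∈ E₁, F ⊂ H) (h2 : ∀ H ∈ E₂, F ⊂ H)
    (hk : MonKill k γ 1 (cutExp (famExp (E₁ ∪ E₂)) F K))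
    (h : ∀ v ∉ F, β + Finsupp.single v 2 ∈ famExp E₁ ∪ famExp E₂) (hγ : ∀ f ∈ F, (γ + β) f < K) :
    γ + β ∈ famExp E₁ ∪ famExp E₂ := by
  rw [cutExp_famExp_union] at hk
  have := MonKill.add_mem_of_one (β := β) (isUpperSet_cutExp (isUpperSet_famExp _) _ _)
    (isUpperSet_cutExp (isUpperSet_famExp _) _ _) (monVanish_cutExp_famExp h1)
    (monVanish_cutExp_famExp h2) hk fun v => ?_
  · have hno : ¬ ∃ f ∈ F, K ≤ (γ + β) f := by
      rintro ⟨f, hf, hle⟩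
      exact absurd (hγ f hf) (not_lt.2 hle)
    exact this.imp (fun h => h.resolve_right hno) (fun h => h.resolve_right hno)
  · by_cases hv : v ∈ F
    · exact ⟨K, Or.inl (Or.inr ⟨v, hv, by simp⟩)⟩
    · exact ⟨2, (h v hv).imp Or.inl Or.inl⟩

lemma colon_symExp (Δ : Set (Finset V)) (F : Finset V) :
    {α | (∑ v ∈ F, Finsupp.single v 2) + α ∈ symExp Δ} = famExp {H ∈ facets Δ | F ⊆ H} := by
  have hwt : ∀ H : Finset V, wt Hᶜ (∑ v ∈ F, Finsupp.single v 2) = ∑ v ∈ F, if v ∈ H then 0 else 2 := by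
    intro H
    rw [wt]
    simp only [Finsupp.finsetSum_apply]
    rw [Finset.sum_comm]
    refine Finset.sum_congr rfl fun v _ => ?_
    have := wt_single Hᶜ v 2
    rw [wt] at this
    rw [this]
    by_cases hv : v ∈ H <;> simp [hv]
  ext α
  constructor
  · rintro h H ⟨hH, hFH⟩
    have := h H hH
    rwa [wt_add, hwt, Finset.sum_eq_zero fun v hv => if_pos (hFH hv), zero_add] at this
  · intro h H hH
    rw [wt_add, hwt]
    by_cases hFH : F ⊆ H
    · exact (h H ⟨hH, hFH⟩).trans (Nat.le_add_left _ _)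
    · obtain ⟨v, hv, hvH⟩ := Finset.not_subset.1 hFH
      have := Finset.single_le_sum (f := fun v => if v ∈ H then 0 else 2) (fun _ _ => Nat.zero_le _) hv
      simp only [hvH, if_false] at this
      omega

lemma exists_monKill_of_quotBuchsbaum {Δ : Set (Finset V)} {H₀ F : Finset V}
    (h : quotBuchsbaum k V (symbolicPower k Δ 2)) (hH₀ : H₀ ∈ facets Δ) (hF : F.Nonempty) (i : ℕ)
    (hi : i + F.card < H₀.card) :
    ∃ γ : V →₀ ℕ, (∀ v ∉ F, γ v = 0) ∧
      ∀ K, MonKill k γ i (cutExp (famExp {H ∈ facets Δ | F ⊆ H}) F K) := by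
  obtain ⟨f, hf⟩ := hF
  refine exists_monKill_cutExp (isUpperSet_famExp _)
    (fun f hf α => mem_famExp_of_single_add fun H hH => hH.2 hf)
    (γ₀ := (∑ v ∈ F, Finsupp.single v 2) + Finsupp.single f 1) ?_ ?_ subset_rfl i hi
  · intro v hv
    have hne : f ≠ v := fun e => hv (e ▸ hf)
    rw [Finsupp.add_apply, Finsupp.finsetSum_apply, Finset.sum_eq_zero]
    · simp [hne]
    · intro u hu
      have hne : u ≠ v := fun e => hv (e ▸ hu)
      simp [hne]
  · intro j hj
    rw [← colon_symExp]
    exact MonKill.colon (isUpperSet_symExp _) _ (monKill_of_quotBuchsbaum hH₀ h hj (by simp))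

end Cut

section Necessity

variable {V : Type} [Fintype V] [DecidableEq V] {k : Type} [Field k] {G : SimpleGraph V}

lemma card_eq_of_quotBuchsbaum {F H : Finset V}
    (h : quotBuchsbaum k V (symbolicPower k (indepComplex G) 2))
    (hF : F ∈ facets (indepComplex G)) (hH : H ∈ facets (indepComplex G)) : F.card = H.card := by
  wlog hle : F.card ≤ H.card generalizing F H
  · exact (this hH hF (by omega)).symm
  by_contra hne
  have hlt : F.card < H.card := by omega
  have hFn : F.Nonempty := by
    obtain ⟨v, hv⟩ := Finset.card_pos.1 (by omega : 0 < H.card)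
    rw [mem_facets_indepComplex] at hF
    by_contra hemp
    rw [Finset.not_nonempty_iff_eq_empty] at hemp
    subst hemp
    obtain ⟨u, hu, -⟩ := hF.2 v (Finset.notMem_empty v)
    exact Finset.notMem_empty u hu
  obtain ⟨γ, hγ, hk⟩ := exists_monKill_of_quotBuchsbaum h hH hFn 0 (by omega)
  have hE : ∀ H ∈ facets (indepComplex G), F ⊆ H → H = F := fun H hH hle =>
    (hF.2 H hH.1 hle).symm
  have := MonKill.add_mem_of_zero (β := 0) (isUpperSet_cutExp (isUpperSet_famExp _) _ _)
    (hk (∑ v, γ v + 1)) fun v => ?_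
  · rw [add_zero] at this
    rcases this with h1 | ⟨f, hf, hle⟩
    · have := h1 F ⟨hF, subset_rfl⟩
      rw [wt_compl_eq_zero subset_rfl hγ] at this
      omega
    · have : γ f ≤ ∑ v, γ v := Finset.single_le_sum (fun _ _ => Nat.zero_le _) (Finset.mem_univ f)
      omega
  · by_cases hv : v ∈ F
    · exact ⟨∑ v, γ v + 1, Or.inr ⟨v, hv, by simp⟩⟩
    · refine ⟨2, Or.inl ?_⟩
      rintro H ⟨hH, hle⟩
      rw [hE H hH hle, zero_add, wt_single, if_pos (Finset.mem_compl.2 hv)]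

lemma card_le_of_quotBuchsbaum {F H₀ : Finset V} {p q : V}
    (h : quotBuchsbaum k V (symbolicPower k (indepComplex G) 2))
    (hH₀ : H₀ ∈ facets (indepComplex G)) (hpq : G.Adj p q) (hFn : F.Nonempty)
    (hF : F ∈ indepComplex G) (hp : ∀ v ∈ F, ¬ G.Adj p v) (hq : ∀ v ∈ F, ¬ G.Adj q v)
    (hmax : ∀ v ∉ F, G.Adj p v ∨ G.Adj q v ∨ ∃ u ∈ F, G.Adj u v) : H₀.card ≤ F.card + 1 := by
  by_contra! hlt
  obtain ⟨γ, hγ, hk⟩ := exists_monKill_of_quotBuchsbaum h hH₀ hFn 1 (by omega)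
  have : Nonempty V := ⟨p⟩
  have hcard := fun H (hH : H ∈ facets (indepComplex G)) => card_eq_of_quotBuchsbaum h hH hH₀
  have hins : ∀ x, (∀ v ∈ F, ¬ G.Adj x v) →
      ∃ H ∈ facets (indepComplex G), insert x F ⊆ H := by
    intro x hx
    refine exists_facet_superset ?_
    intro u hu v hv huv
    rcases Finset.mem_insert.1 hu with rfl | hu' <;> rcases Finset.mem_insert.1 hv with rfl | hv'
    · exact G.irrefl huv
    · exact hx v hv' huv
    · exact hx u hu' huv.symm
    · exact hF u hu' v hv' huv
  have hunion : {H ∈ facets (indepComplex G) | F ⊆ H} =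
      {H | H ∈ facets (indepComplex G) ∧ F ⊆ H ∧ p ∈ H} ∪
        {H | H ∈ facets (indepComplex G) ∧ F ⊆ H ∧ p ∉ H} := by
    ext H
    simp only [Set.mem_union, Set.mem_ofPred_eq]
    tauto
  have hss : ∀ H ∈ facets (indepComplex G), F ⊆ H → F ⊂ H := by
    intro H hH hle
    refine Finset.ssubset_iff_subset_ne.2 ⟨hle, ?_⟩
    rintro rfl
    have := hcard _ hH
    omega
  have hpF : p ∉ F := fun hm => hq p hm hpq.symm
  have hqF : q ∉ F := fun hm => hp q hm hpq
  rw [hunion] at hk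
  have key := MonKill.add_mem_famExp (β := Finsupp.single p 1 + Finsupp.single q 1)
    (fun H hH => hss H hH.1 hH.2.1) (fun H hH => hss H hH.1 hH.2.1) (hk (∑ v, γ v + 1)) ?_ ?_
  · rcases key with key | key
    · obtain ⟨H, hH, hle⟩ := hins p hp
      have hpH := hle (Finset.mem_insert_self _ _)
      have hFH := (Finset.subset_insert p F).trans hle
      have := key H ⟨hH, hFH, hpH⟩
      rw [wt_add, wt_add, wt_compl_eq_zero hFH hγ, wt_single, wt_single,
        if_neg (by simpa using hpH)] at this
      split_ifs at this <;> omega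
    · obtain ⟨H, hH, hle⟩ := hins q hq
      have hqH := hle (Finset.mem_insert_self _ _)
      have hFH := (Finset.subset_insert q F).trans hle
      have := key H ⟨hH, hFH, fun hpH => hH.1 p hpH q hqH hpq⟩
      rw [wt_add, wt_add, wt_compl_eq_zero hFH hγ, wt_single, wt_single,
        if_neg (c := q ∈ Hᶜ) (by simpa using hqH)] at this
      split_ifs at this <;> omega
  · have one : ∀ (x : V) (H : Finset V), x ∉ H → wt Hᶜ (Finsupp.single x 1) = 1 := by
      intro x H hx
      rw [wt_single, if_pos (Finset.mem_compl.2 hx)]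
    have two : ∀ (x : V) (H : Finset V), x ∉ H →
        2 ≤ wt Hᶜ (Finsupp.single p 1 + Finsupp.single q 1 + Finsupp.single x 2) := by
      intro x H hx
      rw [wt_add, wt_single _ x, if_pos (Finset.mem_compl.2 hx)]
      exact Nat.le_add_left _ _
    intro v hv
    rcases hmax v hv with hpv | hqv | ⟨u, hu, huv⟩
    · left
      rintro H ⟨hH, -, hpH⟩
      exact two v H fun hvH => hH.1 p hpH v hvH hpv
    · right
      rintro H ⟨hH, -, hpH⟩
      by_cases hqH : q ∈ H
      · exact two v H fun hvH => hH.1 q hqH v hvH hqv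
      · rw [wt_add, wt_add, one p H hpH, one q H hqH]
        omega
    · left
      rintro H ⟨hH, hFH, -⟩
      exact two v H fun hvH => hH.1 u (hFH hu) v hvH huv
  · intro f hf
    have hpf : p ≠ f := fun e => hpF (e ▸ hf)
    have hqf : q ≠ f := fun e => hqF (e ▸ hf)
    have : γ f ≤ ∑ v, γ v := Finset.single_le_sum (fun _ _ => Nat.zero_le _) (Finset.mem_univ f)
    simp only [Finsupp.add_apply, Finsupp.single_apply, hpf, hqf, if_false]
    omega

lemma exists_edge_of_quotBuchsbaum {H₀ : Finset V} (p : V)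
    (h : quotBuchsbaum k V (symbolicPower k (indepComplex G) 2))
    (hH₀ : H₀ ∈ facets (indepComplex G)) (hd : 2 ≤ H₀.card) (hp : ∃ q, G.Adj p q) :
    ∃ q v, G.Adj p q ∧ ¬ G.Adj p v ∧ ¬ G.Adj q v := by
  by_contra! hall
  have : Nonempty V := ⟨p⟩
  have hk : MonKill k (Finsupp.single p 1) 1 (symExp (indepComplex G)) :=
    monKill_of_quotBuchsbaum hH₀ h (by omega) (by simp)
  have hunion : symExp (indepComplex G) = cutExp (famExp
      ({H | H ∈ facets (indepComplex G) ∧ p ∈ H} ∪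
        {H | H ∈ facets (indepComplex G) ∧ p ∉ H})) ∅ 0 := by
    have : {H | H ∈ facets (indepComplex G) ∧ p ∈ H} ∪
        {H | H ∈ facets (indepComplex G) ∧ p ∉ H} = facets (indepComplex G) := by
      ext H
      simp only [Set.mem_union, Set.mem_ofPred_eq]
      tauto
    rw [this]
    simp [cutExp, famExp, symExp]
  rw [hunion] at hk
  have hss : ∀ H ∈ facets (indepComplex G), ∅ ⊂ H := by
    intro H hH
    rw [Finset.empty_ssubset, ← Finset.card_pos, card_eq_of_quotBuchsbaum h hH hH₀]
    omega
  have hfac : ∀ x, ∃ H ∈ facets (indepComplex G), x ∈ H := by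
    intro x
    obtain ⟨H, hH, hle⟩ := exists_facet_superset (Δ := indepComplex G) (F := {x}) (by
      intro u hu v hv
      rw [Finset.mem_singleton] at hu hv
      rw [hu, hv]
      exact G.irrefl)
    exact ⟨H, hH, hle (Finset.mem_singleton_self x)⟩
  have key := MonKill.add_mem_famExp (β := 0) (fun H hH => hss H hH.1) (fun H hH => hss H hH.1) hk
    ?_ (by simp)
  · obtain ⟨q, hq⟩ := hp
    rw [add_zero] at key
    rcases key with key | key
    · obtain ⟨H, hH, hpH⟩ := hfac p
      have := key H ⟨hH, hpH⟩
      rw [wt_single] at this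
      split_ifs at this <;> omega
    · obtain ⟨H, hH, hqH⟩ := hfac q
      have := key H ⟨hH, fun hpH => hH.1 p hpH q hqH hq⟩
      rw [wt_single] at this
      split_ifs at this <;> omega
  · have two : ∀ (x : V) (H : Finset V), x ∉ H → 2 ≤ wt Hᶜ (0 + Finsupp.single x 2) := by
      intro x H hx
      rw [zero_add, wt_single _ x, if_pos (Finset.mem_compl.2 hx)]
    intro v _
    by_cases hpv : G.Adj p v
    · left
      rintro H ⟨hH, hpH⟩
      exact two v H fun hvH => hH.1 p hpH v hvH hpv
    · right
      rintro H ⟨hH, hpH⟩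
      obtain ⟨u, hu, hpu⟩ := (mem_facets_indepComplex.1 hH).2 p hpH
      exact two v H fun hvH => hH.1 u hu v hvH (hall u v hpu hpv)

end Necessity

section Bipartite

variable {V : Type} [Fintype V] [DecidableEq V] {k : Type} [Field k] {G : SimpleGraph V}

omit [Fintype V] [DecidableEq V] in
lemma nonempty_iso_pathGraph {a b c d : V} (huniv : ∀ v, v = a ∨ v = b ∨ v = c ∨ v = d)
    (hab : G.Adj a b) (hbc : G.Adj b c) (hcd : G.Adj c d)
    (hac : ¬ G.Adj a c) (had : ¬ G.Adj a d) (hbd : ¬ G.Adj b d) :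
    Nonempty (G ≃g SimpleGraph.pathGraph 4) := by
  have hnac : a ≠ c := by rintro rfl; exact had hcd
  have hnad : a ≠ d := by rintro rfl; exact hac hcd.symm
  have hnbd : b ≠ d := by rintro rfl; exact had hab
  have hbij : Function.Bijective ![a, b, c, d] := by
    constructor
    · intro i j hij
      fin_cases i <;> fin_cases j <;>
        simp_all [hab.ne, hab.ne', hbc.ne, hbc.ne', hcd.ne, hcd.ne', hnac.symm, hnad.symm,
          hnbd.symm]
    · intro v
      rcases huniv v with rfl | rfl | rfl | rfl
      exacts [⟨0, rfl⟩, ⟨1, rfl⟩, ⟨2, rfl⟩, ⟨3, rfl⟩]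
  refine ⟨RelIso.symm ⟨Equiv.ofBijective _ hbij, ?_⟩⟩
  intro i j
  rw [SimpleGraph.pathGraph_adj]
  fin_cases i <;> fin_cases j <;>
    simp [hab, hbc, hcd, hac, had, hbd, hab.symm, hbc.symm, hcd.symm, G.adj_comm c a,
      G.adj_comm d a, G.adj_comm d b]

omit [Fintype V] in
lemma side_mem_facets {X : Finset V} (hX : ∀ u v, G.Adj u v → (u ∈ X ↔ v ∉ X))
    (hiso : ∀ v, ∃ w, G.Adj v w) : X ∈ facets (indepComplex G) := by
  rw [mem_facets_indepComplex]
  refine ⟨fun u hu v hv huv => (hX u v huv).1 hu hv, fun v hv => ?_⟩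
  obtain ⟨w, hw⟩ := hiso v
  exact ⟨w, by_contra fun hwX => hv ((hX v w hw).2 hwX), hw⟩

lemma card_le_of_mem_indepComplex {F H : Finset V}
    (h : quotBuchsbaum k V (symbolicPower k (indepComplex G) 2))
    (hF : F ∈ indepComplex G) (hH : H ∈ facets (indepComplex G)) : F.card ≤ H.card := by
  obtain ⟨H', hH', hle⟩ := exists_facet_superset hF
  rw [← card_eq_of_quotBuchsbaum h hH' hH]
  exact Finset.card_le_card hle

lemma nonempty_iso_pathGraph_of_edge {X : Finset V}
    (hX : ∀ u v, G.Adj u v → (u ∈ X ↔ v ∉ X)) (hiso : ∀ v, ∃ w, G.Adj v w)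
    (h : quotBuchsbaum k V (symbolicPower k (indepComplex G) 2)) {p q : V} (hpX : p ∈ X)
    (hpq : G.Adj p q) (hloc : ∃ w, ¬ G.Adj p w ∧ ¬ G.Adj q w) (hdeg : ∃ p' ≠ p, G.Adj q p') :
    Nonempty (G ≃g SimpleGraph.pathGraph 4) := by
  classical
  have hXf := side_mem_facets hX hiso
  have hYf : Xᶜ ∈ facets (indepComplex G) := by
    refine side_mem_facets (fun u v huv => ?_) hiso
    rw [Finset.mem_compl, Finset.mem_compl, not_not, hX u v huv, not_not]
  have hXY : X.card = Xᶜ.card := card_eq_of_quotBuchsbaum h hXf hYf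
  have hind : ∀ A B : Finset V, A ⊆ X → B ⊆ Xᶜ → (∀ a ∈ A, ∀ b ∈ B, ¬ G.Adj a b) →
      A ∪ B ∈ indepComplex G := by
    intro A B hA hB hAB u hu v hv huv
    rcases Finset.mem_union.1 hu with hu | hu <;> rcases Finset.mem_union.1 hv with hv | hv
    · exact (hX u v huv).1 (hA hu) (hA hv)
    · exact hAB u hu v hv huv
    · exact hAB v hv u hu huv.symm
    · exact Finset.mem_compl.1 (hB hu) ((hX u v huv).2 (Finset.mem_compl.1 (hB hv)))
  have hcard : ∀ A B : Finset V, A ⊆ X → B ⊆ Xᶜ → (A ∪ B).card = A.card + B.card := by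
    intro A B hA hB
    refine Finset.card_union_of_disjoint (Finset.disjoint_left.2 fun v hv hv' => ?_)
    exact Finset.mem_compl.1 (hB hv') (hA hv)
  have hqX : q ∉ X := (hX p q hpq).1 hpX
  have hnX : ∀ x, G.Adj q x → x ∈ X := fun x hx => (hX x q hx.symm).2 hqX
  set N : Finset V := Finset.univ.filter fun x => G.Adj q x with hN
  set T : Finset V := Finset.univ.filter fun y => y ∉ X ∧ ∀ x, G.Adj y x → G.Adj q x with hT
  have hNmem : ∀ x, x ∈ N ↔ G.Adj q x := fun x => by simp [hN]
  have hTmem : ∀ y, y ∈ T ↔ y ∉ X ∧ ∀ x, G.Adj y x → G.Adj q x := fun y => by simp [hT]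
  have hNX : N ⊆ X := fun x hx => hnX x ((hNmem x).1 hx)
  have hTY : T ⊆ Xᶜ := fun y hy => Finset.mem_compl.2 ((hTmem y).1 hy).1
  have hqT : q ∈ T := (hTmem q).2 ⟨hqX, fun _ hx => hx⟩
  have hXN : (X \ N).card + N.card = X.card := Finset.card_sdiff_add_card_eq_card hNX
  have hTN : T.card ≤ N.card := by
    have := card_le_of_mem_indepComplex h (hind (X \ N) T Finset.sdiff_subset hTY ?_) hXf
    · rw [hcard _ _ Finset.sdiff_subset hTY] at this
      omega
    · intro a ha b hb hab
      exact (Finset.mem_sdiff.1 ha).2 ((hNmem a).2 (((hTmem b).1 hb).2 a hab.symm))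
  have key : ∀ x, G.Adj q x → (∃ w, ¬ G.Adj x w ∧ ¬ G.Adj q w) →
      N.card ≤ T.card ∧ ∀ y ∈ T, G.Adj x y → y = q := by
    rintro x hqx ⟨w, hxw, hqw⟩
    have hxX := hnX x hqx
    set T' := T.filter fun y => ¬ G.Adj x y with hT'
    have hT'Y : T' ⊆ Xᶜ := (Finset.filter_subset _ _).trans hTY
    have hmax : ∀ v ∉ X \ N ∪ T', G.Adj x v ∨ G.Adj q v ∨ ∃ u ∈ X \ N ∪ T', G.Adj u v := by
      intro v hv
      rw [Finset.mem_union, not_or] at hv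
      by_cases hvX : v ∈ X
      · refine Or.inr (Or.inl ?_)
        by_contra hqv
        exact hv.1 (Finset.mem_sdiff.2 ⟨hvX, fun hvN => hqv ((hNmem v).1 hvN)⟩)
      · by_cases hvT : v ∈ T
        · left
          by_contra hxv
          exact hv.2 (Finset.mem_filter.2 ⟨hvT, hxv⟩)
        · rw [hTmem, not_and] at hvT
          have := hvT hvX
          push Not at this
          obtain ⟨u, hvu, hqu⟩ := this
          refine Or.inr (Or.inr ⟨u, Finset.mem_union_left _ (Finset.mem_sdiff.2 ⟨?_, ?_⟩), hvu.symm⟩)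
          · exact (hX u v hvu.symm).2 hvX
          · exact fun huN => hqu ((hNmem u).1 huN)
    have hne : (X \ N ∪ T').Nonempty := by
      by_cases hw : w ∈ X \ N ∪ T'
      · exact ⟨w, hw⟩
      · rcases hmax w hw with h1 | h1 | ⟨u, hu, -⟩
        · exact absurd h1 hxw
        · exact absurd h1 hqw
        · exact ⟨u, hu⟩
    have hle := card_le_of_quotBuchsbaum h hXf hqx.symm hne
      (hind (X \ N) T' Finset.sdiff_subset hT'Y ?_) ?_ ?_ hmax
    · rw [hcard _ _ Finset.sdiff_subset hT'Y] at hle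
      have hsplit : T'.card + (T.filter fun y => G.Adj x y).card = T.card := by
        rw [add_comm]
        exact Finset.card_filter_add_card_filter_not (fun y => G.Adj x y)
      have hq' : q ∈ T.filter fun y => G.Adj x y := Finset.mem_filter.2 ⟨hqT, hqx.symm⟩
      have hpos := Finset.card_pos.2 ⟨q, hq'⟩
      refine ⟨by omega, fun y hy hxy => ?_⟩
      have hone : (T.filter fun y => G.Adj x y).card ≤ 1 := by omega
      exact Finset.card_le_one.1 hone y (Finset.mem_filter.2 ⟨hy, hxy⟩) q hq'
    · intro a ha b hb hab
      exact (Finset.mem_sdiff.1 ha).2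
        ((hNmem a).2 (((hTmem b).1 (Finset.mem_filter.1 hb).1).2 a hab.symm))
    · intro v hv hxv
      rcases Finset.mem_union.1 hv with hv | hv
      · exact (hX x v hxv).1 hxX (Finset.mem_sdiff.1 hv).1
      · exact (Finset.mem_filter.1 hv).2 hxv
    · intro v hv hqv
      rcases Finset.mem_union.1 hv with hv | hv
      · exact (Finset.mem_sdiff.1 hv).2 ((hNmem v).2 hqv)
      · exact Finset.mem_compl.1 (hT'Y hv) (hnX v hqv)
  obtain ⟨p', hp'p, hqp'⟩ := hdeg
  have hN2 : 1 < N.card :=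
    Finset.one_lt_card.2 ⟨p', (hNmem _).2 hqp', p, (hNmem _).2 hpq.symm, hp'p⟩
  have hT2 : 1 < T.card := lt_of_lt_of_le hN2 (key p hpq.symm hloc).1
  obtain ⟨y, hyT, hyq⟩ := Finset.exists_mem_ne hT2 q
  have hyX := ((hTmem y).1 hyT).1
  obtain ⟨x, hyx⟩ := hiso y
  have hqx := ((hTmem y).1 hyT).2 x hyx
  have hxX := hnX x hqx
  have hcov : ∀ w, G.Adj x w ∨ G.Adj q w := by
    by_contra! hw
    exact hyq ((key x hqx hw).2 y hyT hyx.symm)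
  have hqall : ∀ v ∈ X, G.Adj q v := fun v hv =>
    (hcov v).resolve_left fun hxv => (hX x v hxv).1 hxX hv
  have hxall : ∀ v, v ∉ X → G.Adj x v := fun v hv => (hcov v).resolve_right fun hqv => hv (hnX v hqv)
  have hTall : ∀ v, v ∉ X → v ∈ T := fun v hv =>
    (hTmem v).2 ⟨hv, fun u hvu => hqall u ((hX u v hvu.symm).2 hv)⟩
  have hleaf : ∀ z ∈ X, (∃ v, v ∉ X ∧ ¬ G.Adj z v) → ∀ v, G.Adj z v → v = q := by
    rintro z hz ⟨w, hw, hzw⟩ v hzv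
    exact (key z (hqall z hz) ⟨w, hzw, fun hqw => hw (hnX w hqw)⟩).2 v
      (hTall v ((hX z v hzv).1 hz)) hzv
  have hpleaf : ∀ v, G.Adj p v → v = q := fun v hv =>
    (key p hpq.symm hloc).2 v (hTall v ((hX p v hv).1 hpX)) hv
  have hXleaf : ∀ z ∈ X, z ≠ p → ∀ v, v ∉ X → G.Adj z v := by
    intro z hz hzp v hv
    by_contra hzv
    have hzleaf := hleaf z hz ⟨v, hv, hzv⟩
    have hsub : ({z, p} : Finset V) ⊆ X := by
      intro u hu
      simp only [Finset.mem_insert, Finset.mem_singleton] at hu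
      rcases hu with rfl | rfl <;> assumption
    have hsub' : Xᶜ.erase q ⊆ Xᶜ := Finset.erase_subset _ _
    have := card_le_of_mem_indepComplex h (hind {z, p} (Xᶜ.erase q) hsub hsub' ?_) hXf
    · rw [hcard _ _ hsub hsub', Finset.card_pair hzp,
        Finset.card_erase_of_mem (Finset.mem_compl.2 hqX)] at this
      have hpos : 0 < X.card := Finset.card_pos.2 ⟨p, hpX⟩
      omega
    · intro a ha b hb hab
      simp only [Finset.mem_insert, Finset.mem_singleton] at ha
      refine (Finset.mem_erase.1 hb).1 ?_
      rcases ha with rfl | rfl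
      · exact hzleaf b hab
      · exact hpleaf b hab
  have hpy : ¬ G.Adj p y := fun hpy => hyq (hpleaf y hpy)
  have hxp : x ≠ p := fun e => hpy (e ▸ hyx.symm)
  have hpx : ¬ G.Adj x p := fun hxp => (hX x p hxp).1 hxX hpX
  have hd : X.card ≤ 2 := by
    have := card_le_of_quotBuchsbaum (F := {p}) h hXf hyx.symm (Finset.singleton_nonempty p)
      ?_ ?_ ?_ ?_
    · simpa using this
    · intro u hu v hv
      rw [Finset.mem_singleton] at hu hv
      rw [hu, hv]
      exact G.irrefl
    · intro v hv
      rw [Finset.mem_singleton] at hv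
      exact hv ▸ hpx
    · intro v hv
      rw [Finset.mem_singleton] at hv
      exact hv ▸ fun hyp => hpy hyp.symm
    · intro v hv
      rw [Finset.mem_singleton] at hv
      by_cases hvX : v ∈ X
      · exact Or.inr (Or.inl (hXleaf v hvX hv y hyX).symm)
      · exact Or.inl (hxall v hvX)
  refine nonempty_iso_pathGraph (a := p) (b := q) (c := x) (d := y) (fun v => ?_) hpq hqx hyx.symm
    (fun hpx' => hpx hpx'.symm) hpy (fun hqy => hyX (hnX y hqy))
  have pair : ∀ (Z : Finset V) (a b c : V), Z.card ≤ 2 → a ∈ Z → b ∈ Z → a ≠ b → c ∈ Z →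
      c = a ∨ c = b := by
    intro Z a b c hZ ha hb hab hc
    have hsub : {a, b} ⊆ Z := by
      intro u hu
      simp only [Finset.mem_insert, Finset.mem_singleton] at hu
      rcases hu with rfl | rfl <;> assumption
    have := Finset.eq_of_subset_of_card_le hsub (by rwa [Finset.card_pair hab])
    rw [← this] at hc
    simpa using hc
  by_cases hv : v ∈ X
  · rcases pair X p x v hd hpX hxX hxp.symm hv with h1 | h1 <;> simp [h1]
  · rcases pair Xᶜ q y v (hXY ▸ hd) (Finset.mem_compl.2 hqX) (Finset.mem_compl.2 hyX) hyq.symm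
      (Finset.mem_compl.2 hv) with h1 | h1 <;> simp [h1]

lemma path_or_matching_of_quotBuchsbaum (hbip : G.Colorable 2) (hiso : ∀ v, ∃ w, G.Adj v w)
    (h : quotBuchsbaum k V (symbolicPower k (indepComplex G) 2)) :
    Nonempty (G ≃g SimpleGraph.pathGraph 4) ∨ ∀ v : V, ∃! w, G.Adj v w := by
  classical
  obtain ⟨C⟩ := hbip
  set X : Finset V := Finset.univ.filter fun v => C v = 0 with hXdef
  have hX : ∀ u v, G.Adj u v → (u ∈ X ↔ v ∉ X) := by
    intro u v huv
    have := C.valid huv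
    simp only [hXdef, Finset.mem_filter, Finset.mem_univ, true_and]
    omega
  have hY : ∀ u v, G.Adj u v → (u ∈ Xᶜ ↔ v ∉ Xᶜ) := by
    intro u v huv
    rw [Finset.mem_compl, Finset.mem_compl, not_not, hX u v huv, not_not]
  have hXf := side_mem_facets hX hiso
  have hXY : X.card = Xᶜ.card := card_eq_of_quotBuchsbaum h hXf (side_mem_facets hY hiso)
  by_contra! hcon
  obtain ⟨hpath, v, hv⟩ := hcon
  obtain ⟨w, hw⟩ := hiso v
  have hdeg : ∀ q, G.Adj v q → ∃ q' ≠ q, G.Adj v q' := by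
    intro q hq
    by_contra! hall
    exact hv ⟨q, hq, fun q' hq' => by_contra fun hne => hall q' hne hq'⟩
  have hd : 2 ≤ X.card := by
    obtain ⟨w', hne, hw'⟩ := hdeg w hw
    by_cases hvX : v ∈ X
    · rw [hXY]
      exact Finset.one_lt_card.2 ⟨w', Finset.mem_compl.2 ((hX v w' hw').1 hvX), w,
        Finset.mem_compl.2 ((hX v w hw).1 hvX), hne⟩
    · exact Finset.one_lt_card.2 ⟨w', (hX w' v hw'.symm).2 hvX, w, (hX w v hw.symm).2 hvX, hne⟩
  obtain ⟨q, u, hvq, hvu, hqu⟩ := exists_edge_of_quotBuchsbaum v h hXf hd (hiso v)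
  by_cases hvX : v ∈ X
  · exact hpath.false (nonempty_iso_pathGraph_of_edge hY hiso h
      (Finset.mem_compl.2 ((hX v q hvq).1 hvX)) hvq.symm ⟨u, hqu, hvu⟩ (hdeg q hvq)).some
  · exact hpath.false (nonempty_iso_pathGraph_of_edge hX hiso h
      ((hX q v hvq.symm).2 hvX) hvq.symm ⟨u, hqu, hvu⟩ (hdeg q hvq)).some

end Bipartite

end BuchsbaumAux

end

/-- **Proposition 4.3.** For a bipartite graph `G` (without isolated vertices),
`S/I(G)^{(2)}` is Buchsbaum if and only if `G` is a path of length 3 (a path on 4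
vertices) or a disjoint union of edges. -/
theorem bipartite_second_symbolic_power_buchsbaum_iff {n : ℕ} (k : Type) [Field k]
    (G : SimpleGraph (Fin n)) (hbip : G.Colorable 2) (hiso : noIsolated G) :
    quotBuchsbaum k (Fin n) (symbolicPower k (indepComplex G) 2) ↔
      (Nonempty (G ≃g SimpleGraph.pathGraph 4) ∨ ∀ v : Fin n, ∃! w : Fin n, G.Adj v w) := by
  refine ⟨BuchsbaumAux.path_or_matching_of_quotBuchsbaum hbip hiso, ?_⟩
  rintro (⟨⟨e⟩⟩ | h)
  · exact BuchsbaumAux.quotBuchsbaum_of_iso_pathGraph e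
  · exact BuchsbaumAux.quotBuchsbaum_of_matching h
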